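/- arXiv:1707.08109 — 2 statements merged into one kernel-verified Lean document; each statement's English description precedes it below -/
import Mathlib

section
/- A left-c.e. real α in (0,1) is Martin-Löf random if and only if there exists a universal prefix-free machine U with Ω_U = α. -/
open scoped Classical

/-- A set of binary strings is prefix-free if no element is a proper prefix of another. -/
def PrefixFreeSet (D : Set (List Bool)) : Prop :=
  ∀ σ ∈ D, ∀ τ ∈ D, σ <+: τ → σ = τ

/-- A prefix-free machine: a partial computable function on binary strings
whose domain is prefix-free. -/
structure PFMachine where
  f : List Bool →. List Bool
  partrec : Partrec f
  prefixFree : PrefixFreeSet {σ | (f σ).Dom}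

/-- The halting probability `Ω_M = Σ_{σ ∈ dom M} 2^{-|σ|}` of a prefix-free machine. -/
noncomputable def omegaOf (M : PFMachine) : ℝ :=
  ∑' σ : {σ : List Bool // (M.f σ).Dom}, (2 : ℝ) ^ (-(σ.1.length : ℤ))

/-- A computable nondecreasing sequence of rationals converging to `x`. -/
def LeftCEApprox (q : ℕ → ℚ) (x : ℝ) : Prop :=
  Computable q ∧ Monotone q ∧
    Filter.Tendsto (fun n => (q n : ℝ)) Filter.atTop (nhds x)

/-- A real is left-c.e. if some computable nondecreasing rational sequence converges to it. -/
def LeftCE (x : ℝ) : Prop := ∃ q : ℕ → ℚ, LeftCEApprox q x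

/-- A real is right-c.e. if its negative is left-c.e. -/
def RightCE (x : ℝ) : Prop := LeftCE (-x)

/-- Martin-Löf randomness of a real, via computable sequences of open rational intervals. -/
def MLRandom (x : ℝ) : Prop :=
  ∀ I : ℕ → ℕ → ℚ × ℚ, Computable₂ I →
    (∀ n : ℕ, MeasureTheory.volume
        (⋃ k : ℕ, Set.Ioo (((I n k).1 : ℝ)) (((I n k).2 : ℝ))) ≤ 2 ^ (-(n : ℤ))) →
    x ∉ ⋂ n : ℕ, ⋃ k : ℕ, Set.Ioo (((I n k).1 : ℝ)) (((I n k).2 : ℝ))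

/-- A universal prefix-free machine: it simulates every prefix-free machine
via a fixed prefix. -/
def UniversalPF (U : PFMachine) : Prop :=
  ∀ M : PFMachine, ∃ ρ : List Bool, ∀ σ : List Bool, U.f (ρ ++ σ) = M.f σ

/-- The `i`-th binary digit of a real (of its expansion not ending in all 1s). -/
noncomputable def rdigit (x : ℝ) (i : ℕ) : Bool := decide (⌊x * 2 ^ (i + 1)⌋ % 2 = 1)

/-- The first `n` binary digits of a real. -/
noncomputable def bits (x : ℝ) (n : ℕ) : List Bool := (List.range n).map (rdigit x)

/-- Prefix-free Kolmogorov complexity of `σ` with respect to machine `M`,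
with value `⊤` if `σ` is not in the range. -/
noncomputable def Kf (M : PFMachine) (σ : List Bool) : ℕ∞ :=
  ⨅ p : {p : List Bool // σ ∈ M.f p}, (p.1.length : ℕ∞)

/-- An optimal prefix-free machine: minimizes `K` up to additive constants. -/
def OptimalPF (V : PFMachine) : Prop :=
  ∀ M : PFMachine, ∃ c : ℕ, ∀ σ : List Bool, Kf V σ ≤ Kf M σ + c

/-- Solovay reducibility for left-c.e. reals. -/
def SolovayRed (α β : ℝ) : Prop :=
  ∃ c : ℚ, ∃ f : ℚ →. ℚ, Partrec f ∧
    ∀ q : ℚ, (q : ℝ) < β →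
      ∃ r ∈ f q, (r : ℝ) < α ∧ α - (r : ℝ) < (c : ℝ) * (β - (q : ℝ))

/-- `X` is computable from `Y` with oracle-use `h`. -/
def ComputableFromWithUse (X Y : ℝ) (h : ℕ → ℕ) : Prop :=
  ∃ Φ : List Bool →. List Bool, Partrec Φ ∧
    ∀ n : ℕ, Φ (bits Y (h n)) = Part.some (bits X n)

theorem encode_ofEncodableOfInfinite {α : Type*} [E : Encodable α] [Infinite α] (a : α) :
    (Denumerable.ofEncodableOfInfinite α).toEncodable.encode a =
      Nat.count (· ∈ Set.range E.encode) (E.encode a) := by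
  have : (Denumerable.ofEncodableOfInfinite α).toEncodable.encode a =
     (letI := Encodable.decidableRangeEncode α
     (List.range (E.encode a)).countP (· ∈ Set.range E.encode)) := by
    rfl
  rw [this, Nat.count]
  congr!

/-- The code of a rational number as a pair of codes of its numerator and denominator. -/
def ratCode (q : ℚ) : ℕ := Nat.pair (Equiv.intEquivNat q.num) q.den

theorem encode_rat_eq_count (q : ℚ) :
    Primcodable.toEncodable.encode q = Nat.count (· ∈ Set.range ratCode) (ratCode q) := by
  have h : Rat.instEncodable.encode = ratCode := by
    funext ⟨a, b, c, d⟩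
    rfl
  rw [← h]
  exact encode_ofEncodableOfInfinite (E := Rat.instEncodable) q

theorem intEquivNat_div_two (z : ℤ) :
    (Equiv.intEquivNat z % 2 = 0 → Equiv.intEquivNat z / 2 = z.toNat ∧ (-z).toNat = 0) ∧
    (Equiv.intEquivNat z % 2 = 1 → (Equiv.intEquivNat z + 1) / 2 = (-z).toNat ∧ z.toNat = 0) := by
  cases z with
  | ofNat n =>
    have : Equiv.intEquivNat (Int.ofNat n) = 2 * n := rfl
    rw [this]
    simp
  | negSucc n =>
    have : Equiv.intEquivNat (Int.negSucc n) = 2 * n + 1 := rfl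
    rw [this]
    simp [Int.neg_negSucc]
    omega

theorem intEquivNat_add_one_div_two (z : ℤ) : (Equiv.intEquivNat z + 1) / 2 = z.natAbs := by
  have h := intEquivNat_div_two z
  rcases Nat.mod_two_eq_zero_or_one (Equiv.intEquivNat z) with h0 | h0
  · have := h.1 h0
    omega
  · have := h.2 h0
    omega

theorem mem_range_ratCode (m : ℕ) :
    m ∈ Set.range ratCode ↔ 0 < m.unpair.2 ∧
      ∀ k < m.unpair.2 + 1, ¬ (2 ≤ k ∧ m.unpair.2 % k = 0 ∧ (m.unpair.1 + 1) / 2 % k = 0) := by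
  constructor
  · rintro ⟨q, rfl⟩
    simp only [ratCode, Nat.unpair_pair, intEquivNat_add_one_div_two]
    refine ⟨q.pos, fun k _ ⟨hk, h1, h2⟩ => ?_⟩
    have := Nat.dvd_gcd (Nat.dvd_of_mod_eq_zero h2) (Nat.dvd_of_mod_eq_zero h1)
    rw [q.reduced] at this
    have := Nat.le_of_dvd one_pos this
    omega
  · rintro ⟨h0, h⟩
    set z := Equiv.intEquivNat.symm m.unpair.1 with hz
    have hz' : Equiv.intEquivNat z = m.unpair.1 := by simp [hz]
    rw [← hz', intEquivNat_add_one_div_two] at h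
    have hc : z.natAbs.Coprime m.unpair.2 := by
      by_contra hc
      refine h (z.natAbs.gcd m.unpair.2) ?_ ⟨?_, ?_, ?_⟩
      · exact Nat.lt_succ_of_le (Nat.gcd_le_right _ h0)
      · have := Nat.gcd_pos_of_pos_right z.natAbs h0
        have : z.natAbs.gcd m.unpair.2 ≠ 1 := hc
        omega
      · exact Nat.mod_eq_zero_of_dvd (Nat.gcd_dvd_right _ _)
      · exact Nat.mod_eq_zero_of_dvd (Nat.gcd_dvd_left _ _)
    refine ⟨⟨z, m.unpair.2, h0.ne', hc⟩, ?_⟩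
    simp [ratCode, hz']

theorem primrecPred_mem_range_ratCode : PrimrecPred fun m => m ∈ Set.range ratCode := by
  have h1 : PrimrecRel fun (k m : ℕ) => ¬ (2 ≤ k ∧ m.unpair.2 % k = 0 ∧
      (m.unpair.1 + 1) / 2 % k = 0) := by
    have hd : Primrec fun p : ℕ × ℕ => p.2.unpair.2 :=
      Primrec.snd.comp (Primrec.unpair.comp Primrec.snd)
    have hn : Primrec fun p : ℕ × ℕ => (p.2.unpair.1 + 1) / 2 :=
      Primrec.nat_div.comp (Primrec.succ.comp (Primrec.fst.comp (Primrec.unpair.comp Primrec.snd)))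
        (Primrec.const 2)
    exact PrimrecPred.not ((Primrec.nat_le.comp (Primrec.const 2) Primrec.fst).and
      ((Primrec.eq.comp (Primrec.nat_mod.comp hd Primrec.fst) (Primrec.const 0)).and
        (Primrec.eq.comp (Primrec.nat_mod.comp hn Primrec.fst) (Primrec.const 0))))
  have hd : Primrec fun m : ℕ => m.unpair.2 := Primrec.snd.comp Primrec.unpair
  refine (((Primrec.nat_lt.comp (Primrec.const 0) hd).and
    (h1.forall_lt.comp (Primrec.succ.comp hd) Primrec.id))).of_eq fun m => ?_
  rw [mem_range_ratCode]
  simp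

theorem computable_of_unique_solution {α β : Type*} [Primcodable α] [Denumerable β] {f : α → β}
    {p : α → β → Bool} (hp : Computable₂ p) (h : ∀ a b, p a b = true ↔ b = f a) :
    Computable f := by
  have hb : Computable₂ fun (a : α) (m : ℕ) => p a (Denumerable.ofNat β m) :=
    hp.comp Computable.fst ((Computable.ofNat β).comp Computable.snd)
  have hf := (Partrec.rfind hb.partrec₂).map ((Computable.ofNat β).comp Computable.snd).to₂
  refine Partrec.of_eq_tot hf fun a => ?_
  rw [Part.mem_map_iff]
  refine ⟨Encodable.encode (f a), ?_, by simp⟩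
  rw [Nat.mem_rfind]
  refine ⟨?_, fun {m} hm => ?_⟩
  · have : p a (f a) = true := (h _ _).2 rfl
    simp [this]
  · have : p a (Denumerable.ofNat β m) = false := by
      rw [← Bool.not_eq_true, h]
      rintro h
      rw [← h] at hm
      simp at hm
    simp [this]

theorem computable_ratCode : Computable ratCode := by
  have hP := primrecPred_mem_range_ratCode
  have hc : Primrec fun m => Nat.count (· ∈ Set.range ratCode) m := by
    refine (Primrec.list_length.comp
      (Primrec.listFilter hP |>.comp Primrec.list_range)).of_eq fun m => ?_
    rw [Nat.count, List.countP_eq_length_filter]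
  have hR : PrimrecPred fun p : ℚ × ℕ => p.2 ∈ Set.range ratCode ∧
      Nat.count (· ∈ Set.range ratCode) p.2 = Primcodable.toEncodable.encode p.1 :=
    (hP.comp Primrec.snd).and
      (Primrec.eq.comp (hc.comp Primrec.snd) (Primrec.encode.comp Primrec.fst))
  refine computable_of_unique_solution hR.decide.to_comp.to₂ fun q m => ?_
  rw [decide_eq_true_iff]
  constructor
  · rintro ⟨h1, h2⟩
    exact Nat.count_injective h1 (Set.mem_range_self q) (h2.trans (encode_rat_eq_count q))
  · rintro rfl
    exact ⟨Set.mem_range_self q, (encode_rat_eq_count q).symm⟩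

theorem computable_rat_num_toNat : Computable fun q : ℚ => q.num.toNat := by
  have hi : Computable fun q : ℚ => (ratCode q).unpair.1 :=
    Computable.fst.comp (Computable.unpair.comp computable_ratCode)
  have hg : Primrec fun i : ℕ => if i % 2 = 0 then i / 2 else 0 :=
    Primrec.ite (Primrec.eq.comp (Primrec.nat_mod.comp Primrec.id (Primrec.const 2))
      (Primrec.const 0)) (Primrec.nat_div.comp Primrec.id (Primrec.const 2)) (Primrec.const 0)
  refine (hg.to_comp.comp hi).of_eq fun q => ?_
  have h := intEquivNat_div_two q.num
  simp only [ratCode, Nat.unpair_pair]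
  split_ifs with h0
  · exact (h.1 h0).1
  · exact (h.2 (by omega)).2.symm

theorem computable_rat_neg_num_toNat : Computable fun q : ℚ => (-q.num).toNat := by
  have hi : Computable fun q : ℚ => (ratCode q).unpair.1 :=
    Computable.fst.comp (Computable.unpair.comp computable_ratCode)
  have hg : Primrec fun i : ℕ => if i % 2 = 0 then 0 else (i + 1) / 2 :=
    Primrec.ite (Primrec.eq.comp (Primrec.nat_mod.comp Primrec.id (Primrec.const 2))
      (Primrec.const 0)) (Primrec.const 0) (Primrec.nat_div.comp Primrec.succ (Primrec.const 2))
  refine (hg.to_comp.comp hi).of_eq fun q => ?_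
  have h := intEquivNat_div_two q.num
  simp only [ratCode, Nat.unpair_pair]
  split_ifs with h0
  · exact (h.1 h0).2.symm
  · exact (h.2 (by omega)).1

theorem computable_rat_den : Computable fun q : ℚ => q.den :=
  (Computable.snd.comp (Computable.unpair.comp computable_ratCode)).of_eq fun q => by
    simp [ratCode]

theorem rat_eq_toNat_sub_toNat_div (q : ℚ) :
    q = ((q.num.toNat : ℚ) - ((-q.num).toNat : ℚ)) / (q.den : ℚ) := by
  have h : (q.num : ℚ) = (q.num.toNat : ℚ) - ((-q.num).toNat : ℚ) := by
    have : q.num = (q.num.toNat : ℤ) - ((-q.num).toNat : ℤ) := by omega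
    exact_mod_cast this
  rw [← h, Rat.num_div_den]

/-- A function into the rationals is computable if it is a computable difference of natural numbers
divided by a computable positive natural number. -/
theorem computable_rat_of_sub_div {α : Type*} [Primcodable α] {f : α → ℚ} {p n d : α → ℕ}
    (hp : Computable p) (hn : Computable n) (hd : Computable d) (hd0 : ∀ a, 0 < d a)
    (h : ∀ a, f a = ((p a : ℚ) - n a) / d a) : Computable f := by
  have key : ∀ a (q : ℚ), q = f a ↔
      p a * q.den + (-q.num).toNat * d a = q.num.toNat * d a + n a * q.den := by
    intro a q
    have h1 := rat_eq_toNat_sub_toNat_div q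
    have hq : (0 : ℚ) < q.den := by exact_mod_cast q.pos
    have hda : (0 : ℚ) < d a := by exact_mod_cast hd0 a
    rw [h a]
    conv_lhs => rw [h1]
    rw [div_eq_div_iff hq.ne' hda.ne', ← Nat.cast_inj (R := ℚ)]
    push_cast
    constructor <;> intro h <;> linarith
  have mul₂ : ∀ {u v : α × ℚ → ℕ}, Computable u → Computable v → Computable fun x => u x * v x :=
    fun hu hv => Primrec.nat_mul.to_comp.comp hu hv
  have add₂ : ∀ {u v : α × ℚ → ℕ}, Computable u → Computable v → Computable fun x => u x + v x :=
    fun hu hv => Primrec.nat_add.to_comp.comp hu hv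
  have hpx := hp.comp (Computable.fst (α := α) (β := ℚ))
  have hnx := hn.comp (Computable.fst (α := α) (β := ℚ))
  have hdx := hd.comp (Computable.fst (α := α) (β := ℚ))
  have hP := computable_rat_num_toNat.comp (Computable.snd (α := α) (β := ℚ))
  have hN := computable_rat_neg_num_toNat.comp (Computable.snd (α := α) (β := ℚ))
  have hD := computable_rat_den.comp (Computable.snd (α := α) (β := ℚ))
  have hb : Computable₂ fun (a : α) (q : ℚ) =>
      decide (p a * q.den + (-q.num).toNat * d a = q.num.toNat * d a + n a * q.den) :=
    (Primrec.eq (α := ℕ)).decide.to_comp.comp (add₂ (mul₂ hpx hD) (mul₂ hN hdx))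
      (add₂ (mul₂ hP hdx) (mul₂ hnx hD))
  exact computable_of_unique_solution hb fun a q => by rw [decide_eq_true_iff, key]

theorem computable₂_rat_add : Computable₂ fun q r : ℚ => q + r := by
  have P1 := computable_rat_num_toNat.comp (Computable.fst (α := ℚ) (β := ℚ))
  have N1 := computable_rat_neg_num_toNat.comp (Computable.fst (α := ℚ) (β := ℚ))
  have D1 := computable_rat_den.comp (Computable.fst (α := ℚ) (β := ℚ))
  have P2 := computable_rat_num_toNat.comp (Computable.snd (α := ℚ) (β := ℚ))
  have N2 := computable_rat_neg_num_toNat.comp (Computable.snd (α := ℚ) (β := ℚ))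
  have D2 := computable_rat_den.comp (Computable.snd (α := ℚ) (β := ℚ))
  have mul := Primrec.nat_mul.to_comp
  have add := Primrec.nat_add.to_comp
  refine computable_rat_of_sub_div (add.comp (mul.comp P1 D2) (mul.comp P2 D1))
    (add.comp (mul.comp N1 D2) (mul.comp N2 D1)) (mul.comp D1 D2)
    (fun a => Nat.mul_pos a.1.pos a.2.pos) fun a => ?_
  have h1 : (a.1.den : ℚ) ≠ 0 := by exact_mod_cast a.1.pos.ne'
  have h2 : (a.2.den : ℚ) ≠ 0 := by exact_mod_cast a.2.pos.ne'
  beta_reduce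
  conv_lhs => rw [rat_eq_toNat_sub_toNat_div a.1, rat_eq_toNat_sub_toNat_div a.2]
  rw [div_add_div _ _ h1 h2]
  push_cast
  congr 1
  ring

theorem computable₂_rat_mul : Computable₂ fun q r : ℚ => q * r := by
  have P1 := computable_rat_num_toNat.comp (Computable.fst (α := ℚ) (β := ℚ))
  have N1 := computable_rat_neg_num_toNat.comp (Computable.fst (α := ℚ) (β := ℚ))
  have D1 := computable_rat_den.comp (Computable.fst (α := ℚ) (β := ℚ))
  have P2 := computable_rat_num_toNat.comp (Computable.snd (α := ℚ) (β := ℚ))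
  have N2 := computable_rat_neg_num_toNat.comp (Computable.snd (α := ℚ) (β := ℚ))
  have D2 := computable_rat_den.comp (Computable.snd (α := ℚ) (β := ℚ))
  have mul := Primrec.nat_mul.to_comp
  have add := Primrec.nat_add.to_comp
  refine computable_rat_of_sub_div (add.comp (mul.comp P1 P2) (mul.comp N1 N2))
    (add.comp (mul.comp P1 N2) (mul.comp N1 P2)) (mul.comp D1 D2)
    (fun a => Nat.mul_pos a.1.pos a.2.pos) fun a => ?_
  beta_reduce
  conv_lhs => rw [rat_eq_toNat_sub_toNat_div a.1, rat_eq_toNat_sub_toNat_div a.2]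
  rw [div_mul_div_comm]
  push_cast
  congr 1
  ring

theorem computable_rat_natCast : Computable fun n : ℕ => (n : ℚ) :=
  computable_rat_of_sub_div Computable.id (Computable.const 0) (Computable.const 1)
    (fun _ => one_pos) fun n => by simp

theorem primrec_two_pow : Primrec fun n : ℕ => 2 ^ n :=
  (Primrec.nat_rec₁ 1 (Primrec.nat_double.comp Primrec.snd).to₂).of_eq fun n => by
    induction n with
    | zero => rfl
    | succ n ih =>
      change 2 * _ = _
      rw [ih, pow_succ, mul_comm]

theorem computable_rat_half_pow : Computable fun n : ℕ => ((1 / 2 : ℚ) ^ n) :=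
  computable_rat_of_sub_div (p := fun _ => 1) (n := fun _ => 0) (d := fun n => 2 ^ n)
    (Computable.const 1) (Computable.const 0)
    primrec_two_pow.to_comp
    (fun _ => by positivity) fun n => by simp

theorem computable_rat_two_pow : Computable fun n : ℕ => ((2 : ℚ) ^ n) :=
  computable_rat_of_sub_div (p := fun n => 2 ^ n) (n := fun _ => 0) (d := fun _ => 1)
    primrec_two_pow.to_comp
    (Computable.const 0) (Computable.const 1) (fun _ => by positivity) fun n => by simp

theorem computable₂_rat_sub : Computable₂ fun q r : ℚ => q - r :=
  (computable₂_rat_add.comp Computable.fst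
    (computable₂_rat_mul.comp (Computable.const (-1)) Computable.snd)).of_eq fun p => by ring

theorem computable₂_rat_le : Computable₂ fun q r : ℚ => decide (q ≤ r) := by
  have P1 := computable_rat_num_toNat.comp (Computable.fst (α := ℚ) (β := ℚ))
  have N1 := computable_rat_neg_num_toNat.comp (Computable.fst (α := ℚ) (β := ℚ))
  have D1 := computable_rat_den.comp (Computable.fst (α := ℚ) (β := ℚ))
  have P2 := computable_rat_num_toNat.comp (Computable.snd (α := ℚ) (β := ℚ))
  have N2 := computable_rat_neg_num_toNat.comp (Computable.snd (α := ℚ) (β := ℚ))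
  have D2 := computable_rat_den.comp (Computable.snd (α := ℚ) (β := ℚ))
  have mul := Primrec.nat_mul.to_comp
  have add := Primrec.nat_add.to_comp
  refine (Primrec.nat_le.decide.to_comp.comp (add.comp (mul.comp P1 D2) (mul.comp N2 D1))
    (add.comp (mul.comp P2 D1) (mul.comp N1 D2))).of_eq fun a => ?_
  rw [decide_eq_decide]
  have h1 : (0 : ℚ) < a.1.den := by exact_mod_cast a.1.pos
  have h2 : (0 : ℚ) < a.2.den := by exact_mod_cast a.2.pos
  conv_rhs => rw [rat_eq_toNat_sub_toNat_div a.1, rat_eq_toNat_sub_toNat_div a.2]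
  rw [div_le_div_iff₀ h1 h2, ← Nat.cast_le (α := ℚ)]
  push_cast
  constructor <;> intro h <;> linarith

theorem computable₂_rat_lt : Computable₂ fun q r : ℚ => decide (q < r) :=
  (Primrec.not.to_comp.comp (computable₂_rat_le.comp Computable.snd Computable.fst)).of_eq
    fun a => by simp [← decide_not]

theorem computable₂_rat_min : Computable₂ fun q r : ℚ => min q r :=
  (Computable.cond computable₂_rat_le Computable.fst Computable.snd).of_eq fun a => by
    by_cases h : a.1 ≤ a.2 <;> simp [h]
    exact (not_le.1 h).le

theorem computable₂_rat_max : Computable₂ fun q r : ℚ => max q r :=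
  (Computable.cond computable₂_rat_le Computable.snd Computable.fst).of_eq fun a => by
    by_cases h : a.1 ≤ a.2 <;> simp [h]
    exact (not_le.1 h).le

theorem computable_rat_floor : Computable fun q : ℚ => ⌊q⌋₊ :=
  (Primrec.nat_div.to_comp.comp computable_rat_num_toNat computable_rat_den).of_eq fun q => by
    rw [← Int.floor_toNat, Rat.floor_def']
    obtain h | h := le_or_gt 0 q.num
    · obtain ⟨k, hk⟩ := Int.eq_ofNat_of_zero_le h
      rw [hk]
      rfl
    · rw [Int.toNat_of_nonpos h.le, Nat.zero_div,
        Int.toNat_of_nonpos (Int.ediv_neg_of_neg_of_pos h (by exact_mod_cast q.pos)).le]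

/-- The left endpoint of the dyadic interval of reals whose expansion starts with a string. -/
def cylLeft : List Bool → ℚ
  | [] => 0
  | b :: σ => ((if b then 1 else 0) + cylLeft σ) / 2

/-- The half-open dyadic interval of reals whose binary expansion starts with `σ`. -/
def cyl (σ : List Bool) : Set ℝ := Set.Ico (cylLeft σ : ℝ) (cylLeft σ + (1 / 2) ^ σ.length)

theorem mem_cyl_cons (b : Bool) (σ : List Bool) (x : ℝ) :
    x ∈ cyl (b :: σ) ↔ 2 * x - (if b then 1 else 0) ∈ cyl σ := by
  simp only [cyl, cylLeft, Set.mem_Ico, List.length_cons, pow_succ]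
  cases b <;> simp only [Bool.false_eq_true, if_true, if_false, Rat.cast_div, Rat.cast_add,
    Rat.cast_one, Rat.cast_zero, Rat.cast_ofNat] <;>
    constructor <;> rintro ⟨h1, h2⟩ <;> constructor <;> linarith

theorem cylLeft_mem_cyl (σ : List Bool) : (cylLeft σ : ℝ) ∈ cyl σ :=
  ⟨le_rfl, lt_add_of_pos_right _ (by positivity)⟩

theorem mem_unit_of_mem_cyl {σ : List Bool} : ∀ {x : ℝ}, x ∈ cyl σ → x ∈ Set.Ico (0 : ℝ) 1 := by
  induction σ with
  | nil => intro x hx; simpa [cyl, cylLeft] using hx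
  | cons b σ ih =>
    intro x hx
    have := ih ((mem_cyl_cons b σ x).1 hx)
    cases b <;> simp only [Set.mem_Ico, Bool.false_eq_true, if_true, if_false] at this ⊢ <;>
      constructor <;> linarith

theorem cyl_subset_of_prefix {σ τ : List Bool} (h : σ <+: τ) : cyl τ ⊆ cyl σ := by
  induction σ generalizing τ with
  | nil => intro x hx; simpa [cyl, cylLeft] using mem_unit_of_mem_cyl hx
  | cons b σ ih =>
    obtain ⟨t, rfl⟩ := h
    intro x hx
    rw [List.cons_append, mem_cyl_cons] at hx
    rw [mem_cyl_cons]
    exact ih (List.prefix_append σ t) hx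

theorem prefix_of_mem_cyl {σ τ : List Bool} {x : ℝ} (hσ : x ∈ cyl σ) (hτ : x ∈ cyl τ)
    (h : σ.length ≤ τ.length) : σ <+: τ := by
  induction σ generalizing τ x with
  | nil => exact List.nil_prefix
  | cons b σ ih =>
    cases τ with
    | nil => simp at h
    | cons c τ =>
      rw [mem_cyl_cons] at hσ hτ
      have h1 := mem_unit_of_mem_cyl hσ
      have h2 := mem_unit_of_mem_cyl hτ
      have hbc : b = c := by
        cases b <;> cases c <;> simp at h1 h2 ⊢ <;> linarith
      subst hbc
      exact List.cons_prefix_cons.2 ⟨rfl, ih hσ hτ (by simpa using h)⟩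

theorem exists_mem_cyl (n : ℕ) : ∀ {x : ℝ}, x ∈ Set.Ico (0 : ℝ) 1 →
    ∃ σ : List Bool, σ.length = n ∧ x ∈ cyl σ := by
  induction n with
  | zero => intro x hx; exact ⟨[], rfl, by simpa [cyl, cylLeft] using hx⟩
  | succ n ih =>
    intro x hx
    obtain h | h := lt_or_ge x (1 / 2)
    · obtain ⟨σ, h1, h2⟩ := ih (x := 2 * x) ⟨by linarith [hx.1], by linarith⟩
      exact ⟨false :: σ, by simp [h1], by rw [mem_cyl_cons]; simpa using h2⟩
    · obtain ⟨σ, h1, h2⟩ := ih (x := 2 * x - 1) ⟨by linarith, by linarith [hx.2]⟩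
      exact ⟨true :: σ, by simp [h1], by rw [mem_cyl_cons]; simpa using h2⟩

theorem exists_cylLeft_eq (σ : List Bool) : ∃ k : ℕ, cylLeft σ = k * (1 / 2) ^ σ.length := by
  induction σ with
  | nil => exact ⟨0, by simp [cylLeft]⟩
  | cons b σ ih =>
    obtain ⟨k, hk⟩ := ih
    have h2 : (2 : ℚ) ^ σ.length * (1 / 2) ^ σ.length = 1 := by rw [← mul_pow]; norm_num
    refine ⟨(if b then 2 ^ σ.length else 0) + k, ?_⟩
    rw [cylLeft, hk, List.length_cons, pow_succ]
    cases b <;> simp only [Bool.false_eq_true, if_true, if_false, Nat.cast_add, Nat.cast_pow,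
      Nat.cast_ofNat, Nat.cast_zero]
    · ring
    · linear_combination (-1 / 2) * h2

theorem prefix_or_prefix_of_mem_cyl {σ τ : List Bool} {x : ℝ} (hσ : x ∈ cyl σ) (hτ : x ∈ cyl τ) :
    σ <+: τ ∨ τ <+: σ :=
  (le_total σ.length τ.length).imp (prefix_of_mem_cyl hσ hτ) (prefix_of_mem_cyl hτ hσ)

theorem volume_cyl (σ : List Bool) :
    MeasureTheory.volume (cyl σ) = ENNReal.ofReal ((1 / 2) ^ σ.length) := by
  rw [cyl, Real.volume_Ico, add_sub_cancel_left]

/-- The weight of a string restricted to a set of strings. -/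
noncomputable def wt (D : Set (List Bool)) : List Bool → ℝ :=
  D.indicator fun σ => (1 / 2) ^ σ.length

theorem wt_nonneg (D : Set (List Bool)) (σ : List Bool) : 0 ≤ wt D σ :=
  Set.indicator_nonneg (fun _ _ => by positivity) σ

theorem hasSum_wt {D : Set (List Bool)} (hD : PrefixFreeSet D) :
    HasSum (wt D) (MeasureTheory.volume (⋃ σ ∈ D, cyl σ)).toReal := by
  have hdisj : D.PairwiseDisjoint cyl := by
    intro σ hσ τ hτ hne
    rw [Function.onFun, Set.disjoint_left]
    intro x hx hx'
    rcases prefix_or_prefix_of_mem_cyl hx hx' with h | h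
    · exact hne (hD σ hσ τ hτ h)
    · exact hne (hD τ hτ σ hσ h).symm
  have hv : MeasureTheory.volume (⋃ σ ∈ D, cyl σ) = ∑' σ, ENNReal.ofReal (wt D σ) := by
    rw [MeasureTheory.measure_biUnion D.to_countable hdisj fun σ _ => measurableSet_Ico,
      tsum_subtype D fun σ => MeasureTheory.volume (cyl σ)]
    refine tsum_congr fun σ => ?_
    by_cases h : σ ∈ D <;> simp [wt, h, volume_cyl]
  have hfin : MeasureTheory.volume (⋃ σ ∈ D, cyl σ) ≤ 1 := by
    have : (⋃ σ ∈ D, cyl σ) ⊆ Set.Ico (0 : ℝ) 1 :=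
      Set.iUnion₂_subset fun σ _ x hx => mem_unit_of_mem_cyl hx
    simpa using MeasureTheory.measure_mono (μ := MeasureTheory.volume) this
  rw [hv] at hfin ⊢
  have := ENNReal.hasSum_toReal (hfin.trans_lt ENNReal.one_lt_top).ne
  rwa [← ENNReal.tsum_toReal_eq fun _ => ENNReal.ofReal_ne_top,
    funext fun σ => ENNReal.toReal_ofReal (wt_nonneg D σ)] at this

theorem tsum_wt_le_one {D : Set (List Bool)} (hD : PrefixFreeSet D) : ∑' σ, wt D σ ≤ 1 := by
  rw [(hasSum_wt hD).tsum_eq]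
  have : (⋃ σ ∈ D, cyl σ) ⊆ Set.Ico (0 : ℝ) 1 :=
    Set.iUnion₂_subset fun σ _ x hx => mem_unit_of_mem_cyl hx
  have := MeasureTheory.measure_mono (μ := MeasureTheory.volume) this
  rw [Real.volume_Ico] at this
  simpa using ENNReal.toReal_mono (by simp) this

theorem omegaOf_eq (M : PFMachine) : omegaOf M = ∑' σ, wt {σ | (M.f σ).Dom} σ := by
  rw [omegaOf, wt, ← tsum_subtype]
  refine tsum_congr fun σ => ?_
  rw [zpow_neg, zpow_natCast, one_div, inv_pow]

theorem PrefixFreeSet.mono {D E : Set (List Bool)} (hE : PrefixFreeSet E) (h : D ⊆ E) :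
    PrefixFreeSet D := fun σ hσ τ hτ => hE σ (h hσ) τ (h hτ)

/-- The weight of the part of a set inside the cone above `π`. -/
theorem tsum_wt_cone (π : List Bool) (D : Set (List Bool)) :
    ∑' σ, wt {σ | π <+: σ ∧ σ ∈ D} σ = (1 / 2) ^ π.length * ∑' σ, wt {σ | π ++ σ ∈ D} σ := by
  rw [← tsum_mul_left, ← (List.append_right_injective π).tsum_eq]
  · refine tsum_congr fun σ => ?_
    by_cases h : π ++ σ ∈ D <;> simp [wt, h, pow_add, mul_comm]
  · intro σ hσ
    simp only [wt, Function.mem_support, ne_eq, Set.indicator_apply_eq_zero, not_forall] at hσ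
    obtain ⟨⟨⟨t, rfl⟩, _⟩, _⟩ := hσ
    exact ⟨t, rfl⟩

theorem tsum_wt_split (p : List Bool → Prop) {D : Set (List Bool)} (hD : PrefixFreeSet D) :
    ∑' σ, wt D σ = ∑' σ, wt {σ | p σ ∧ σ ∈ D} σ + ∑' σ, wt {σ | ¬ p σ ∧ σ ∈ D} σ := by
  rw [← Summable.tsum_add]
  · refine tsum_congr fun σ => ?_
    by_cases h : p σ <;> by_cases h' : σ ∈ D <;> simp [wt, h, h']
  · exact (hasSum_wt (hD.mono fun σ h => h.2)).summable
  · exact (hasSum_wt (hD.mono fun σ h => h.2)).summable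

/-- The dyadic rounding of the `s`-th term of a rational sequence to precision `s`. -/
def dyFloor (g : ℕ → ℚ) (s : ℕ) : ℚ := ⌊g s * 2 ^ s⌋₊ * (1 / 2) ^ s

/-- A decidable prefix-free set of strings whose weight is the limit of `g`. -/
def filler (g : ℕ → ℚ) : Set (List Bool) :=
  {σ | dyFloor g (σ.length - 1) ≤ cylLeft σ ∧ cylLeft σ < dyFloor g σ.length}

theorem dyFloor_le {g : ℕ → ℚ} (h0 : ∀ s, 0 ≤ g s) (s : ℕ) : dyFloor g s ≤ g s := by
  have h := Nat.floor_le (a := g s * 2 ^ s) (mul_nonneg (h0 s) (by positivity))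
  have h2 : (2 : ℚ) ^ s * (1 / 2) ^ s = 1 := by rw [← mul_pow]; norm_num
  calc dyFloor g s ≤ g s * 2 ^ s * (1 / 2) ^ s := mul_le_mul_of_nonneg_right h (by positivity)
    _ = g s := by rw [mul_assoc, h2, mul_one]

theorem lt_dyFloor_add (g : ℕ → ℚ) (s : ℕ) : g s < dyFloor g s + (1 / 2) ^ s := by
  have h := Nat.lt_floor_add_one (g s * 2 ^ s)
  have h2 : (2 : ℚ) ^ s * (1 / 2) ^ s = 1 := by rw [← mul_pow]; norm_num
  have : g s * 2 ^ s * (1 / 2) ^ s < (⌊g s * 2 ^ s⌋₊ + 1) * (1 / 2) ^ s :=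
    mul_lt_mul_of_pos_right h (by positivity)
  rw [mul_assoc, h2, mul_one, add_mul, one_mul] at this
  exact this

theorem dyFloor_monotone {g : ℕ → ℚ} (h0 : ∀ s, 0 ≤ g s) (hg : Monotone g) :
    Monotone (dyFloor g) := by
  refine monotone_nat_of_le_succ fun s => ?_
  have h : ⌊g s * 2 ^ s⌋₊ * 2 ≤ ⌊g (s + 1) * 2 ^ (s + 1)⌋₊ := by
    refine Nat.le_floor ?_
    have h1 := Nat.floor_le (a := g s * 2 ^ s) (mul_nonneg (h0 s) (by positivity))
    have h2 : g s * 2 ^ s ≤ g (s + 1) * 2 ^ s :=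
      mul_le_mul_of_nonneg_right (hg (Nat.le_succ s)) (by positivity)
    rw [pow_succ]
    push_cast
    linarith
  have h' : (⌊g s * 2 ^ s⌋₊ : ℚ) * 2 ≤ ⌊g (s + 1) * 2 ^ (s + 1)⌋₊ := by exact_mod_cast h
  have := mul_le_mul_of_nonneg_right h' (by positivity : (0 : ℚ) ≤ (1 / 2) ^ (s + 1))
  rw [dyFloor, dyFloor]
  calc _ = (⌊g s * 2 ^ s⌋₊ : ℚ) * 2 * (1 / 2) ^ (s + 1) := by rw [pow_succ]; ring
    _ ≤ _ := this

theorem cylLeft_add_le_dyFloor {g : ℕ → ℚ} {σ : List Bool} (hσ : σ ∈ filler g) :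
    cylLeft σ + (1 / 2) ^ σ.length ≤ dyFloor g σ.length := by
  obtain ⟨k, hk⟩ := exists_cylLeft_eq σ
  have h := hσ.2
  have hp : (0 : ℚ) < (1 / 2) ^ σ.length := by positivity
  rw [hk, dyFloor, mul_lt_mul_iff_left₀ hp, Nat.cast_lt] at h
  rw [hk, dyFloor, ← add_one_mul]
  exact mul_le_mul_of_nonneg_right (by exact_mod_cast h) hp.le

theorem prefixFreeSet_filler {g : ℕ → ℚ} (h0 : ∀ s, 0 ≤ g s) (hg : Monotone g) :
    PrefixFreeSet (filler g) := by
  intro σ hσ τ hτ h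
  refine h.eq_of_length (h.length_le.antisymm (not_lt.1 fun hlt => ?_))
  have h1 := cylLeft_add_le_dyFloor hσ
  have h2 := dyFloor_monotone h0 hg (show σ.length ≤ τ.length - 1 by omega)
  have h3 := (cyl_subset_of_prefix h (cylLeft_mem_cyl τ)).2
  have h4 := h1.trans (h2.trans hτ.1)
  have h5 : (cylLeft σ + (1 / 2) ^ σ.length : ℝ) ≤ cylLeft τ := by
    have := Rat.cast_le (K := ℝ).2 h4
    push_cast at this
    exact this
  linarith

theorem iUnion_cyl_filler {g : ℕ → ℚ} {γ : ℝ} (h0 : ∀ s, 0 ≤ g s) (hg : Monotone g)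
    (h1 : g 0 < 1) (hγ : Filter.Tendsto (fun s => (g s : ℝ)) Filter.atTop (nhds γ)) (hγ1 : γ ≤ 1) :
    ⋃ σ ∈ filler g, cyl σ = Set.Ico 0 γ := by
  have hgR : Monotone fun s => (g s : ℝ) := fun a b h => Rat.cast_le.2 (hg h)
  ext x
  simp only [Set.mem_iUnion, exists_prop]
  constructor
  · rintro ⟨σ, hσ, hx⟩
    have h2 : (cylLeft σ + (1 / 2) ^ σ.length : ℝ) ≤ g σ.length := by
      have := Rat.cast_le (K := ℝ).2 ((cylLeft_add_le_dyFloor hσ).trans (dyFloor_le h0 _))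
      push_cast at this
      exact this
    exact ⟨(mem_unit_of_mem_cyl hx).1, hx.2.trans_le (h2.trans (hgR.ge_of_tendsto hγ _))⟩
  · rintro ⟨hx0, hxγ⟩
    have hex : ∃ s, x < dyFloor g s := by
      have hp : Filter.Tendsto (fun s : ℕ => (g s : ℝ) - (1 / 2) ^ s) Filter.atTop
          (nhds (γ - 0)) :=
        hγ.sub (tendsto_pow_atTop_nhds_zero_of_lt_one (by norm_num) (by norm_num))
      rw [sub_zero] at hp
      obtain ⟨s, hs⟩ := (hp.eventually (lt_mem_nhds hxγ)).exists
      refine ⟨s, hs.trans ?_⟩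
      have : (g s : ℝ) < dyFloor g s + (1 / 2) ^ s := by
        have := Rat.cast_lt (K := ℝ).2 (lt_dyFloor_add g s)
        push_cast at this
        exact this
      linarith
    have hs := Nat.find_spec hex
    have hmin := fun m => Nat.find_min hex (m := m)
    set s := Nat.find hex
    cases hs' : s with
    | zero =>
      rw [hs'] at hs
      have : ⌊g 0⌋₊ = 0 := Nat.floor_eq_zero.2 h1
      simp [dyFloor, this] at hs
      linarith
    | succ t =>
      rw [hs'] at hs
      have ht := not_lt.1 (hmin t (by omega))
      obtain ⟨σ, hl, hx⟩ := exists_mem_cyl (t + 1) ⟨hx0, hxγ.trans_le hγ1⟩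
      refine ⟨σ, ⟨?_, ?_⟩, hx⟩
      · obtain ⟨k, hk⟩ := exists_cylLeft_eq σ
        have hp : (0 : ℚ) < (1 / 2) ^ (t + 1) := by positivity
        have h3 : (dyFloor g t : ℝ) < cylLeft σ + (1 / 2) ^ σ.length := ht.trans_lt hx.2
        have h4 : dyFloor g t < cylLeft σ + (1 / 2) ^ σ.length := by
          rw [← Rat.cast_lt (K := ℝ)]
          push_cast
          exact h3
        have h5 : dyFloor g t = (⌊g t * 2 ^ t⌋₊ * 2 : ℕ) * (1 / 2) ^ (t + 1) := by
          rw [dyFloor, pow_succ]; push_cast; ring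
        rw [hk, hl, ← add_one_mul, h5, mul_lt_mul_iff_left₀ hp] at h4
        rw [hk, hl, Nat.add_sub_cancel, h5]
        refine mul_le_mul_of_nonneg_right ?_ hp.le
        have : ⌊g t * 2 ^ t⌋₊ * 2 < k + 1 := by exact_mod_cast h4
        exact_mod_cast Nat.lt_succ_iff.1 this
      · rw [hl]
        exact_mod_cast hx.1.trans_lt hs

theorem tsum_wt_filler {g : ℕ → ℚ} {γ : ℝ} (h0 : ∀ s, 0 ≤ g s) (hg : Monotone g)
    (h1 : g 0 < 1) (hγ : Filter.Tendsto (fun s => (g s : ℝ)) Filter.atTop (nhds γ)) (hγ1 : γ ≤ 1) :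
    ∑' σ, wt (filler g) σ = γ := by
  rw [(hasSum_wt (prefixFreeSet_filler h0 hg)).tsum_eq, iUnion_cyl_filler h0 hg h1 hγ hγ1,
    Real.volume_Ico, sub_zero, ENNReal.toReal_ofReal]
  exact ge_of_tendsto' hγ fun s => by exact_mod_cast h0 s

open Nat.Partrec (Code)

theorem exists_code_list {f : List Bool →. List Bool} (hf : Partrec f) :
    ∃ e : Code, ∀ σ, e.eval (Encodable.encode σ) = (f σ).map Encodable.encode := by
  obtain ⟨e, he⟩ := Code.exists_code.1 hf
  exact ⟨e, fun σ => by simp [he]⟩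

/-- Whether the program `e` halts on the code of `σ` within `s` steps. -/
def haltsBy (e : Code) (s : ℕ) (σ : List Bool) : Bool :=
  (e.evaln s (Encodable.encode σ)).isSome

theorem primrec_haltsBy : Primrec fun x : Code × ℕ × List Bool => haltsBy x.1 x.2.1 x.2.2 :=
  Primrec.option_isSome.comp <| Code.primrec_evaln.comp <|
    ((Primrec.fst.comp Primrec.snd).pair Primrec.fst).pair
      (Primrec.encode.comp (Primrec.snd.comp Primrec.snd))

/-- `h s` is an increasing sequence of finite sets exhausting `D`, the elements of the `s`-th set
having codes below `s`. -/
structure StageApprox (h : ℕ → List Bool → Bool) (D : Set (List Bool)) : Prop where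
  encode_lt : ∀ {s σ}, h s σ = true → Encodable.encode σ < s
  mono : ∀ {s t σ}, s ≤ t → h s σ = true → h t σ = true
  mem_iff : ∀ {σ}, σ ∈ D ↔ ∃ s, h s σ = true

theorem stageApprox_haltsBy {f : List Bool →. List Bool} {e : Code}
    (he : ∀ σ, e.eval (Encodable.encode σ) = (f σ).map Encodable.encode) :
    StageApprox (haltsBy e) {σ | (f σ).Dom} where
  encode_lt {s σ} h := by
    obtain ⟨x, hx⟩ := Option.isSome_iff_exists.1 h
    exact Code.evaln_bound hx
  mono {s t σ} hst h := by
    obtain ⟨x, hx⟩ := Option.isSome_iff_exists.1 h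
    exact Option.isSome_iff_exists.2 ⟨x, Code.evaln_mono hst hx⟩
  mem_iff {σ} := by
    have h1 : (f σ).Dom ↔ (e.eval (Encodable.encode σ)).Dom := by rw [he]; rfl
    rw [Set.mem_ofPred_eq, h1, Part.dom_iff_mem]
    simp only [Code.evaln_complete, haltsBy, Option.isSome_iff_exists, Option.mem_def]
    exact exists_comm

theorem StageApprox.and {h : ℕ → List Bool → Bool} {D : Set (List Bool)} (H : StageApprox h D)
    (p : List Bool → Bool) : StageApprox (fun s σ => p σ && h s σ) {σ | p σ = true ∧ σ ∈ D} where
  encode_lt {s σ} h := H.encode_lt (Bool.and_eq_true_iff.1 h).2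
  mono {s t σ} hst h := by
    rw [Bool.and_eq_true_iff] at h ⊢
    exact ⟨h.1, H.mono hst h.2⟩
  mem_iff {σ} := by
    simp only [Set.mem_ofPred_eq, H.mem_iff, Bool.and_eq_true_iff, exists_and_left]

/-- The weight of the string coded by `n`, if it belongs to `h`. -/
def codeWeight (h : List Bool → Bool) (n : ℕ) : ℚ :=
  ((Encodable.decode (α := List Bool) n).map fun σ =>
    bif decide (Encodable.encode σ = n) && h σ then (1 / 2) ^ σ.length else 0).getD 0

/-- The total weight of the `s`-th stage of an approximation. -/
def mass (h : ℕ → List Bool → Bool) (s : ℕ) : ℚ := ∑ n ∈ Finset.range s, codeWeight (h s) n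

theorem codeWeight_encode (h : List Bool → Bool) (σ : List Bool) :
    (codeWeight h (Encodable.encode σ) : ℝ) = wt {σ | h σ = true} σ := by
  cases h' : h σ <;> simp [codeWeight, wt, h']

theorem codeWeight_eq_zero {h : List Bool → Bool} {n : ℕ}
    (hn : n ∉ Set.range (Encodable.encode (α := List Bool))) : codeWeight h n = 0 := by
  rw [codeWeight]
  cases hd : Encodable.decode (α := List Bool) n with
  | none => rfl
  | some σ =>
    have : Encodable.encode σ ≠ n := fun h => hn ⟨σ, h⟩
    simp [this]

theorem computable₂_nat_eq : Computable₂ fun a b : ℕ => decide (a = b) :=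
  (Primrec.eq (α := ℕ)).decide.to_comp

theorem computable_codeWeight {Q : Type*} [Primcodable Q] {h : Q → List Bool → Bool}
    (hh : Computable₂ h) : Computable₂ fun (q : Q) (n : ℕ) => codeWeight (h q) n := by
  have h1 : Computable₂ fun (y : Q × ℕ) (σ : List Bool) =>
      decide (Encodable.encode σ = y.2) && h y.1 σ :=
    Primrec.and.to_comp.comp
      (computable₂_nat_eq.comp (Computable.encode.comp Computable.snd)
        (Computable.snd.comp Computable.fst))
      (hh.comp (Computable.fst.comp Computable.fst) Computable.snd)
  have h2 : Computable₂ fun (y : Q × ℕ) (σ : List Bool) =>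
      bif decide (Encodable.encode σ = y.2) && h y.1 σ then ((1 / 2) ^ σ.length : ℚ) else 0 :=
    Computable.cond h1
      (computable_rat_half_pow.comp (Computable.list_length.comp Computable.snd))
      (Computable.const 0)
  exact Computable.option_getD
    (Computable.option_map (Computable.decode.comp Computable.snd) h2) (Computable.const 0)

theorem computable_sum_range {Q : Type*} [Primcodable Q] {f : Q → ℕ → ℚ} {m : Q → ℕ}
    (hf : Computable₂ f) (hm : Computable m) :
    Computable fun q => ∑ n ∈ Finset.range (m q), f q n := by
  have hs : Computable₂ fun (q : Q) (x : ℕ × ℚ) => x.2 + f q x.1 :=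
    computable₂_rat_add.comp (Computable.snd.comp Computable.snd)
      (hf.comp Computable.fst (Computable.fst.comp Computable.snd))
  refine (Computable.nat_rec hm (Computable.const 0) hs).of_eq fun q => ?_
  induction m q with
  | zero => rfl
  | succ m ih => rw [Finset.sum_range_succ, ← ih]

theorem computable_mass {P : Type*} [Primcodable P] {h : P → ℕ → List Bool → Bool}
    (hh : Computable₂ fun (x : P × ℕ) (σ : List Bool) => h x.1 x.2 σ) :
    Computable₂ fun p s => mass (h p) s :=
  computable_sum_range (computable_codeWeight hh) Computable.snd

theorem mass_zero (h : ℕ → List Bool → Bool) : mass h 0 = 0 := rfl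

namespace StageApprox

variable {h : ℕ → List Bool → Bool} {D : Set (List Bool)}

theorem mass_eq_tsum (H : StageApprox h D) (s : ℕ) :
    (mass h s : ℝ) = ∑' σ, wt {σ | h s σ = true} σ := by
  have h1 : (mass h s : ℝ) = ∑' n, (codeWeight (h s) n : ℝ) := by
    rw [mass, Rat.cast_sum, tsum_eq_sum]
    intro n hn
    by_cases hr : n ∈ Set.range (Encodable.encode (α := List Bool))
    · obtain ⟨σ, rfl⟩ := hr
      rw [codeWeight_encode, wt, Set.indicator_of_notMem]
      exact fun hσ => hn (Finset.mem_range.2 (H.encode_lt hσ))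
    · rw [codeWeight_eq_zero hr, Rat.cast_zero]
  rw [h1, ← (Encodable.encode_injective (α := List Bool)).tsum_eq]
  · exact tsum_congr fun σ => codeWeight_encode _ σ
  · intro n hn
    by_contra hr
    exact hn (by simp [codeWeight_eq_zero hr])

theorem subset (H : StageApprox h D) (s : ℕ) : {σ | h s σ = true} ⊆ D :=
  fun _ hσ => H.mem_iff.2 ⟨s, hσ⟩

theorem mass_monotone (H : StageApprox h D) (hD : PrefixFreeSet D) : Monotone (mass h) := by
  intro s t hst
  rw [← Rat.cast_le (K := ℝ), H.mass_eq_tsum, H.mass_eq_tsum]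
  refine Summable.tsum_le_tsum (fun σ => ?_) (hasSum_wt (hD.mono (H.subset s))).summable
    (hasSum_wt (hD.mono (H.subset t))).summable
  exact Set.indicator_le_indicator_of_subset (fun _ hσ => H.mono hst hσ)
    (fun _ => by positivity) σ

theorem tendsto_mass (H : StageApprox h D) (hD : PrefixFreeSet D) :
    Filter.Tendsto (fun s => (mass h s : ℝ)) Filter.atTop (nhds (∑' σ, wt D σ)) := by
  simp only [H.mass_eq_tsum]
  refine tendsto_tsum_of_dominated_convergence (hasSum_wt hD).summable (fun σ => ?_)
    (Filter.Eventually.of_forall fun s σ => ?_)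
  · refine tendsto_nhds_of_eventually_eq ?_
    by_cases hσ : σ ∈ D
    · obtain ⟨s, hs⟩ := H.mem_iff.1 hσ
      filter_upwards [Filter.eventually_ge_atTop s] with t ht
      have hσt : σ ∈ {σ | h t σ = true} := H.mono ht hs
      rw [wt, wt, Set.indicator_of_mem hσ, Set.indicator_of_mem hσt]
    · refine Filter.Eventually.of_forall fun s => ?_
      rw [wt, wt, Set.indicator_of_notMem hσ, Set.indicator_of_notMem]
      exact fun h => hσ (H.subset s h)
  · rw [Real.norm_of_nonneg (wt_nonneg _ σ)]
    exact Set.indicator_le_indicator_of_subset (H.subset s) (fun _ => by positivity) σ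

theorem mass_le_one (H : StageApprox h D) (hD : PrefixFreeSet D) (s : ℕ) : mass h s ≤ 1 := by
  rw [← Rat.cast_le (K := ℝ), H.mass_eq_tsum, Rat.cast_one]
  exact tsum_wt_le_one (hD.mono (H.subset s))

end StageApprox

theorem primrec₂_isPrefixOf : Primrec₂ fun σ τ : List Bool => σ.isPrefixOf τ := by
  have h : Primrec₂ fun σ τ : List Bool => decide (τ.take σ.length = σ) :=
    (Primrec.eq (α := List Bool)).decide.comp
      (Primrec.list_take.comp (Primrec.list_length.comp Primrec.fst) Primrec.snd) Primrec.fst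
  refine h.of_eq fun σ τ => ?_
  rw [Bool.eq_iff_iff, decide_eq_true_iff, List.isPrefixOf_iff_prefix, List.prefix_iff_eq_take,
    eq_comm]

theorem computable_cylLeft : Computable cylLeft := by
  have hs : Primrec₂ fun (_ : List Bool) (x : Bool × ℕ × ℕ) =>
      ((bif x.1 then x.2.2 else 0) + x.2.1, 2 * x.2.2) :=
    Primrec.pair
      (Primrec.nat_add.comp
        (Primrec.cond (Primrec.fst.comp Primrec.snd)
          (Primrec.snd.comp (Primrec.snd.comp Primrec.snd)) (Primrec.const 0))
        (Primrec.fst.comp (Primrec.snd.comp Primrec.snd)))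
      (Primrec.nat_mul.comp (Primrec.const 2) (Primrec.snd.comp (Primrec.snd.comp Primrec.snd)))
  have hf : Primrec fun σ : List Bool => σ.foldr (fun b (x : ℕ × ℕ) =>
      ((bif b then x.2 else 0) + x.1, 2 * x.2)) (0, 1) :=
    Primrec.list_foldr Primrec.id (Primrec.const (0, 1)) hs
  have key : ∀ σ : List Bool, 0 < (σ.foldr (fun b (x : ℕ × ℕ) =>
      ((bif b then x.2 else 0) + x.1, 2 * x.2)) (0, 1)).2 ∧
      cylLeft σ * (σ.foldr (fun b (x : ℕ × ℕ) =>
        ((bif b then x.2 else 0) + x.1, 2 * x.2)) (0, 1)).2 =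
      (σ.foldr (fun b (x : ℕ × ℕ) => ((bif b then x.2 else 0) + x.1, 2 * x.2)) (0, 1)).1 := by
    intro σ
    induction σ with
    | nil => simp [cylLeft]
    | cons b σ ih =>
      obtain ⟨h1, h2⟩ := ih
      rw [List.foldr_cons, cylLeft]
      generalize σ.foldr _ _ = x at h1 h2 ⊢
      refine ⟨by simpa using h1, ?_⟩
      cases b <;> simp only [cond_true, cond_false, if_true, Bool.false_eq_true, if_false,
        Nat.cast_add, Nat.cast_mul, Nat.cast_ofNat, Nat.cast_zero] <;> linarith
  refine computable_rat_of_sub_div (Primrec.fst.comp hf).to_comp (Computable.const 0)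
    (Primrec.snd.comp hf).to_comp (fun σ => (key σ).1) fun σ => ?_
  rw [Nat.cast_zero, sub_zero, eq_div_iff (Nat.cast_ne_zero.2 (key σ).1.ne'), (key σ).2]

/-- The characteristic function of `filler`. -/
def inFiller (g : ℕ → ℚ) (σ : List Bool) : Bool :=
  decide (dyFloor g (σ.length - 1) ≤ cylLeft σ) && decide (cylLeft σ < dyFloor g σ.length)

theorem inFiller_iff {g : ℕ → ℚ} {σ : List Bool} : inFiller g σ = true ↔ σ ∈ filler g := by
  simp [inFiller, filler]

theorem computable₂_dyFloor {P : Type*} [Primcodable P] {g : P → ℕ → ℚ} (hg : Computable₂ g) :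
    Computable₂ fun p s => dyFloor (g p) s :=
  computable₂_rat_mul.comp
    (computable_rat_natCast.comp (computable_rat_floor.comp
      (computable₂_rat_mul.comp hg (computable_rat_two_pow.comp Computable.snd))))
    (computable_rat_half_pow.comp Computable.snd)

theorem computable₂_inFiller {P : Type*} [Primcodable P] {g : P → ℕ → ℚ} (hg : Computable₂ g) :
    Computable₂ fun p σ => inFiller (g p) σ := by
  have hl : Computable fun x : P × List Bool => cylLeft x.2 :=
    computable_cylLeft.comp Computable.snd
  have hn : Computable fun x : P × List Bool => x.2.length :=
    Computable.list_length.comp Computable.snd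
  have h1 : Computable fun x : P × List Bool => dyFloor (g x.1) (x.2.length - 1) :=
    (computable₂_dyFloor hg).comp Computable.fst (Primrec.pred.to_comp.comp hn)
  have h2 : Computable fun x : P × List Bool => dyFloor (g x.1) x.2.length :=
    (computable₂_dyFloor hg).comp Computable.fst hn
  exact Primrec.and.to_comp.comp (computable₂_rat_le.comp h1 hl) (computable₂_rat_lt.comp hl h2)

/-- Reads `falseᵏ true τ` and runs the `k`-th function on `τ`. -/
def dispatch (F : ℕ → List Bool →. List Bool) : List Bool →. List Bool := fun σ =>
  bif decide (σ.idxOf true < σ.length) then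
    F (σ.idxOf true) (σ.drop (σ.idxOf true + 1)) else Part.none

/-- The self-delimiting unary code of a number. -/
def unaryCode (k : ℕ) : List Bool := List.replicate k false ++ [true]

theorem idxOf_unaryCode_append (k : ℕ) (τ : List Bool) :
    (unaryCode k ++ τ).idxOf true = k := by
  induction k with
  | zero => rfl
  | succ k ih =>
    rw [unaryCode, List.replicate_succ, List.cons_append, List.cons_append, List.idxOf_cons_ne]
    · exact congrArg Nat.succ ih
    · decide

theorem length_unaryCode (k : ℕ) : (unaryCode k).length = k + 1 := by simp [unaryCode]

theorem dispatch_unaryCode_append (F : ℕ → List Bool →. List Bool) (k : ℕ) (τ : List Bool) :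
    dispatch F (unaryCode k ++ τ) = F k τ := by
  have h : k < (unaryCode k ++ τ).length := by rw [List.length_append, length_unaryCode]; omega
  rw [dispatch, idxOf_unaryCode_append, decide_eq_true h, cond_true,
    List.drop_left' (length_unaryCode k)]

theorem exists_of_dispatch_dom {F : ℕ → List Bool →. List Bool} {σ : List Bool}
    (h : (dispatch F σ).Dom) : ∃ k τ, σ = unaryCode k ++ τ := by
  have hlt : σ.idxOf true < σ.length := by
    by_contra hn
    rw [dispatch, decide_eq_false hn, cond_false] at h
    exact h
  clear h
  induction σ with
  | nil => simp at hlt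
  | cons b σ ih =>
    cases b with
    | true => exact ⟨0, σ, rfl⟩
    | false =>
      rw [List.idxOf_cons_ne _ (by decide), List.length_cons, Nat.succ_lt_succ_iff] at hlt
      obtain ⟨k, τ, rfl⟩ := ih hlt
      exact ⟨k + 1, τ, by simp [unaryCode, List.replicate_succ]⟩

theorem partrec_dispatch {F : ℕ → List Bool →. List Bool} (hF : Partrec₂ F) :
    Partrec (dispatch F) := by
  have hi : Primrec fun σ : List Bool => σ.idxOf true :=
    Primrec.list_idxOf.comp (Primrec.const true) Primrec.id
  have hlt : Primrec fun σ : List Bool => decide (σ.idxOf true < σ.length) :=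
    Primrec.nat_lt.decide.comp hi Primrec.list_length
  have hd : Primrec fun σ : List Bool => σ.drop (σ.idxOf true + 1) :=
    Primrec.list_drop.comp (Primrec.succ.comp hi) Primrec.id
  exact Partrec.cond hlt.to_comp (hF.comp hi.to_comp hd.to_comp) Partrec.none

theorem unaryCode_append_prefix {k l : ℕ} {σ τ : List Bool}
    (h : unaryCode k ++ σ <+: unaryCode l ++ τ) : k = l ∧ σ <+: τ := by
  obtain ⟨t, ht⟩ := h
  have hk : k = l := by
    rw [← idxOf_unaryCode_append k (σ ++ t), ← idxOf_unaryCode_append l τ, ← ht, List.append_assoc]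
  subst hk
  rw [List.append_assoc, List.append_cancel_left_eq] at ht
  exact ⟨rfl, t, ht⟩

/-- The machine dispatching to a uniformly partial recursive family of prefix-free machines. -/
def dispatchMachine (F : ℕ → List Bool →. List Bool) (hF : Partrec₂ F)
    (hD : ∀ k, PrefixFreeSet {σ | (F k σ).Dom}) : PFMachine where
  f := dispatch F
  partrec := partrec_dispatch hF
  prefixFree := by
    intro σ hσ τ hτ h
    obtain ⟨k, σ, rfl⟩ := exists_of_dispatch_dom hσ
    obtain ⟨l, τ, rfl⟩ := exists_of_dispatch_dom hτ
    obtain ⟨rfl, h'⟩ := unaryCode_append_prefix h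
    rw [Set.mem_ofPred_eq, dispatch_unaryCode_append] at hσ hτ
    rw [hD k σ hσ τ hτ h']

theorem dispatchMachine_f (F : ℕ → List Bool →. List Bool) (hF : Partrec₂ F)
    (hD : ∀ k, PrefixFreeSet {σ | (F k σ).Dom}) : (dispatchMachine F hF hD).f = dispatch F := rfl

/-- At stage `k`, no other string comparable with `σ` has halted under `c`. -/
def accepts (c : Code) (k : ℕ) (σ : List Bool) : Prop :=
  ∀ n < k, ((Encodable.decode (α := List Bool) n).map fun τ =>
    haltsBy c k τ && !decide (τ = σ) && (σ.isPrefixOf τ || τ.isPrefixOf σ)).getD false = false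

theorem accepts_iff {c : Code} {k : ℕ} {σ : List Bool} :
    accepts c k σ ↔ ∀ τ, haltsBy c k τ = true → (σ <+: τ ∨ τ <+: σ) → τ = σ := by
  constructor
  · intro h τ hτ hc
    obtain ⟨x, hx⟩ := Option.isSome_iff_exists.1 hτ
    have := h _ (Code.evaln_bound hx)
    simp only [Encodable.encodek, Option.map_some, Option.getD_some, hτ, Bool.true_and,
      Bool.and_eq_false_iff, Bool.not_eq_false', decide_eq_true_iff] at this
    refine this.resolve_right fun h' => ?_
    rw [Bool.eq_false_iff, ne_eq, Bool.or_eq_true_iff, List.isPrefixOf_iff_prefix,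
      List.isPrefixOf_iff_prefix] at h'
    exact h' hc
  · intro h n _
    cases hd : Encodable.decode (α := List Bool) n with
    | none => rfl
    | some τ =>
      rw [Option.map_some, Option.getD_some, Bool.eq_false_iff]
      intro ht
      simp only [Bool.and_eq_true_iff, Bool.or_eq_true_iff, List.isPrefixOf_iff_prefix,
        Bool.not_eq_true', decide_eq_false_iff_not] at ht
      exact ht.1.2 (h τ ht.1.1 ht.2)

theorem primrecPred_accepts :
    PrimrecPred fun x : Code × ℕ × List Bool => accepts x.1 x.2.1 x.2.2 := by
  have h1 : Primrec₂ fun (y : ℕ × Code × ℕ × List Bool) (τ : List Bool) =>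
      haltsBy y.2.1 y.2.2.1 τ && !decide (τ = y.2.2.2) &&
        (y.2.2.2.isPrefixOf τ || τ.isPrefixOf y.2.2.2) := by
    have hσ : Primrec fun z : (ℕ × Code × ℕ × List Bool) × List Bool => z.1.2.2.2 :=
      Primrec.snd.comp (Primrec.snd.comp (Primrec.snd.comp Primrec.fst))
    have hx : Primrec fun z : (ℕ × Code × ℕ × List Bool) × List Bool =>
        (z.1.2.1, z.1.2.2.1, z.2) :=
      (Primrec.fst.comp (Primrec.snd.comp Primrec.fst)).pair
        ((Primrec.fst.comp (Primrec.snd.comp (Primrec.snd.comp Primrec.fst))).pair Primrec.snd)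
    have ha := primrec_haltsBy.comp hx
    have hb := Primrec.not.comp ((Primrec.eq (α := List Bool)).decide.comp Primrec.snd hσ)
    have hc := Primrec.or.comp (primrec₂_isPrefixOf.comp hσ Primrec.snd)
      (primrec₂_isPrefixOf.comp Primrec.snd hσ)
    exact Primrec.and.comp (Primrec.and.comp ha hb) hc
  have h2 : PrimrecRel fun (n : ℕ) (x : Code × ℕ × List Bool) =>
      ((Encodable.decode (α := List Bool) n).map fun τ =>
        haltsBy x.1 x.2.1 τ && !decide (τ = x.2.2) &&
          (x.2.2.isPrefixOf τ || τ.isPrefixOf x.2.2)).getD false = false :=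
    Primrec.eq.comp
      (Primrec.option_getD.comp
        (Primrec.option_map (Primrec.decode.comp Primrec.fst) h1) (Primrec.const false))
      (Primrec.const false)
  exact (h2.forall_mem_list.comp
    (Primrec.list_range.comp (Primrec.fst.comp Primrec.snd)) Primrec.id).of_eq
      fun x => by simp [accepts]

/-- Runs the program `c`, keeping only a prefix-free part of its domain. -/
noncomputable def pfEval (c : Code) : List Bool →. List Bool := fun σ =>
  (Nat.rfind fun k => (haltsBy c k σ : Part Bool)).bind fun k =>
    ((bif decide (accepts c k σ) then
      (c.evaln k (Encodable.encode σ)).bind Encodable.decode else none : Option (List Bool)) :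
      Part (List Bool))

theorem partrec₂_pfEval : Partrec₂ pfEval := by
  have h1 : Partrec fun x : Code × List Bool =>
      Nat.rfind fun k => (haltsBy x.1 k x.2 : Part Bool) := by
    have hx : Primrec fun z : (Code × List Bool) × ℕ => (z.1.1, z.2, z.1.2) :=
      (Primrec.fst.comp Primrec.fst).pair (Primrec.snd.pair (Primrec.snd.comp Primrec.fst))
    have := (primrec_haltsBy.comp hx).to_comp.partrec
    exact Partrec.rfind this
  have hx : Primrec fun z : (Code × List Bool) × ℕ => (z.1.1, z.2, z.1.2) :=
    (Primrec.fst.comp Primrec.fst).pair (Primrec.snd.pair (Primrec.snd.comp Primrec.fst))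
  have ha := (primrecPred_accepts.comp hx).decide
  have he : Primrec fun z : (Code × List Bool) × ℕ =>
      z.1.1.evaln z.2 (Encodable.encode z.1.2) :=
    Code.primrec_evaln.comp ((Primrec.snd.pair (Primrec.fst.comp Primrec.fst)).pair
      (Primrec.encode.comp (Primrec.snd.comp Primrec.fst)))
  have hd : Primrec₂ fun (_ : (Code × List Bool) × ℕ) (m : ℕ) =>
      Encodable.decode (α := List Bool) m := Primrec.decode.comp Primrec.snd
  have hc := Primrec.cond ha (Primrec.option_bind he hd) (Primrec.const none)
  have ho := Computable.ofOption hc.to_comp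
  exact h1.bind ho

theorem exists_of_pfEval_dom {c : Code} {σ : List Bool} (h : (pfEval c σ).Dom) :
    ∃ k, haltsBy c k σ = true ∧ accepts c k σ := by
  obtain ⟨y, hy⟩ := Part.dom_iff_mem.1 h
  obtain ⟨k, hk, hy⟩ := Part.mem_bind_iff.1 hy
  refine ⟨k, by simpa using Nat.rfind_spec hk, ?_⟩
  by_contra hn
  simp [hn] at hy

theorem prefixFreeSet_pfEval (c : Code) : PrefixFreeSet {σ | (pfEval c σ).Dom} := by
  intro σ hσ τ hτ h
  obtain ⟨k, hk, hak⟩ := exists_of_pfEval_dom hσ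
  obtain ⟨l, hl, hal⟩ := exists_of_pfEval_dom hτ
  have mono : ∀ {s t : ℕ} {σ : List Bool}, s ≤ t → haltsBy c s σ = true →
      haltsBy c t σ = true := by
    intro s t σ hst h
    obtain ⟨x, hx⟩ := Option.isSome_iff_exists.1 h
    exact Option.isSome_iff_exists.2 ⟨x, Code.evaln_mono hst hx⟩
  obtain hkl | hlk := le_total k l
  · exact accepts_iff.1 hal σ (mono hkl hk) (Or.inr h)
  · exact (accepts_iff.1 hak τ (mono hlk hl) (Or.inl h)).symm

theorem pfEval_eq {f : List Bool →. List Bool} (hf : PrefixFreeSet {σ | (f σ).Dom}) {e : Code}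
    (he : ∀ σ, e.eval (Encodable.encode σ) = (f σ).map Encodable.encode) (σ : List Bool) :
    pfEval e σ = f σ := by
  have H := stageApprox_haltsBy he
  have hacc : ∀ k, haltsBy e k σ = true → accepts e k σ := by
    intro k hk
    refine accepts_iff.2 fun τ hτ h => ?_
    have h1 := H.subset k hk
    have h2 := H.subset k hτ
    exact h.elim (fun h => (hf σ h1 τ h2 h).symm) (hf τ h2 σ h1)
  have hval : ∀ k v, e.evaln k (Encodable.encode σ) = some v →
      ∃ y ∈ f σ, Encodable.encode y = v := by
    intro k v hv
    have := Code.evaln_sound hv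
    rw [he] at this
    exact (Part.mem_map_iff _).1 this
  refine Part.ext fun y => ⟨fun hy => ?_, fun hy => ?_⟩
  · obtain ⟨k, hk, hy⟩ := Part.mem_bind_iff.1 hy
    have hk' : haltsBy e k σ = true := by simpa using Nat.rfind_spec hk
    rw [decide_eq_true (hacc k hk'), cond_true, Part.mem_ofOption] at hy
    obtain ⟨v, hv, hy⟩ := Option.bind_eq_some_iff.1 hy
    obtain ⟨z, hz, rfl⟩ := hval k v hv
    rw [Encodable.encodek, Option.some_inj] at hy
    exact hy ▸ hz
  · obtain ⟨k, hk⟩ := H.mem_iff.1 (show σ ∈ {σ | (f σ).Dom} from Part.dom_iff_mem.2 ⟨y, hy⟩)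
    have hdom : (Nat.rfind fun k => (haltsBy e k σ : Part Bool)).Dom :=
      Nat.rfind_dom'.2 ⟨k, by simpa using hk, fun _ => trivial⟩
    obtain ⟨l, hl⟩ := Part.dom_iff_mem.1 hdom
    have hl' : haltsBy e l σ = true := by simpa using Nat.rfind_spec hl
    refine Part.mem_bind_iff.2 ⟨l, hl, ?_⟩
    rw [decide_eq_true (hacc l hl'), cond_true, Part.mem_ofOption]
    obtain ⟨v, hv⟩ := Option.isSome_iff_exists.1 hl'
    obtain ⟨z, hz, rfl⟩ := hval l v hv
    rw [hv, Option.mem_def, Option.bind_some, Encodable.encodek, Part.mem_unique hz hy]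

theorem exists_universal : ∃ U : PFMachine, UniversalPF U := by
  have hF : Partrec₂ fun k => pfEval (Denumerable.ofNat Code k) :=
    partrec₂_pfEval.comp ((Computable.ofNat Code).comp Computable.fst) Computable.snd
  refine ⟨dispatchMachine (fun k => pfEval (Denumerable.ofNat Code k)) hF
    fun k => prefixFreeSet_pfEval _, fun M => ?_⟩
  obtain ⟨e, he⟩ := exists_code_list M.partrec
  refine ⟨unaryCode (Encodable.encode e), fun σ => ?_⟩
  rw [dispatchMachine_f, dispatch_unaryCode_append, Denumerable.ofNat_encode]
  exact pfEval_eq M.prefixFree he σ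

/-- Moves `x` to the right end of the interval `J` containing it, returning `B` plus the length
of the jump. -/
def jump (J : ℚ × ℚ) (x B : ℚ) : ℚ :=
  bif decide (J.1 < x) && decide (x < J.2) then B + (J.2 - x) else B

/-- The total length of the jumps made by a point driven by `m` that leaves every interval of `J`
it is found in. -/
def jumpSum (J : ℕ → ℚ × ℚ) (m : ℕ → ℚ) (s : ℕ) : ℚ :=
  Nat.rec 0 (fun t B => jump (J t.unpair.1) (m t + B) B) s

theorem jump_cases (J : ℚ × ℚ) (x B : ℚ) :
    (J.1 < x ∧ x < J.2 ∧ jump J x B = B + (J.2 - x)) ∨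
      (¬ (J.1 < x ∧ x < J.2) ∧ jump J x B = B) := by
  by_cases h : J.1 < x ∧ x < J.2
  · exact Or.inl ⟨h.1, h.2, by simp [jump, h]⟩
  · refine Or.inr ⟨h, ?_⟩
    rw [jump, ← Bool.decide_and, decide_eq_false h, cond_false]

theorem jumpSum_succ (J : ℕ → ℚ × ℚ) (m : ℕ → ℚ) (s : ℕ) :
    jumpSum J m (s + 1) = jump (J s.unpair.1) (m s + jumpSum J m s) (jumpSum J m s) := rfl

theorem jumpSum_monotone (J : ℕ → ℚ × ℚ) (m : ℕ → ℚ) : Monotone (jumpSum J m) := by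
  refine monotone_nat_of_le_succ fun s => ?_
  rw [jumpSum_succ]
  obtain ⟨_, h, h'⟩ | ⟨_, h'⟩ := jump_cases (J s.unpair.1) (m s + jumpSum J m s) (jumpSum J m s) <;>
    rw [h']
  linarith

theorem jumpSum_nonneg (J : ℕ → ℚ × ℚ) (m : ℕ → ℚ) (s : ℕ) : 0 ≤ jumpSum J m s :=
  jumpSum_monotone J m (Nat.zero_le s)

theorem computable₂_jumpSum {P : Type*} [Primcodable P] {J : P → ℕ → ℚ × ℚ} {m : P → ℕ → ℚ}
    (hJ : Computable₂ J) (hm : Computable₂ m) : Computable₂ fun p s => jumpSum (J p) (m p) s := by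
  have ht : Computable fun y : (P × ℕ) × ℕ × ℚ => y.2.1 := Computable.fst.comp Computable.snd
  have hp : Computable fun y : (P × ℕ) × ℕ × ℚ => y.1.1 := Computable.fst.comp Computable.fst
  have hB : Computable fun y : (P × ℕ) × ℕ × ℚ => y.2.2 := Computable.snd.comp Computable.snd
  have hi : Computable fun y : (P × ℕ) × ℕ × ℚ => J y.1.1 y.2.1.unpair.1 :=
    hJ.comp hp (Computable.fst.comp (Computable.unpair.comp ht))
  have hx : Computable fun y : (P × ℕ) × ℕ × ℚ => m y.1.1 y.2.1 + y.2.2 :=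
    computable₂_rat_add.comp (hm.comp hp ht) hB
  have hs : Computable₂ fun (q : P × ℕ) (x : ℕ × ℚ) =>
      jump (J q.1 x.1.unpair.1) (m q.1 x.1 + x.2) x.2 :=
    Computable.cond
      (Primrec.and.to_comp.comp (computable₂_rat_lt.comp (Computable.fst.comp hi) hx)
        (computable₂_rat_lt.comp hx (Computable.snd.comp hi)))
      (computable₂_rat_add.comp hB (computable₂_rat_sub.comp (Computable.snd.comp hi) hx)) hB
  exact Computable.nat_rec Computable.snd (Computable.const 0) hs

theorem ofReal_jumpSum_le (J : ℕ → ℚ × ℚ) {m : ℕ → ℚ} (hm : Monotone m) (s : ℕ) :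
    ENNReal.ofReal (jumpSum J m s) ≤ MeasureTheory.volume
      ((⋃ k, Set.Ioo ((J k).1 : ℝ) (J k).2) ∩ Set.Iio ((m s + jumpSum J m s : ℚ) : ℝ)) := by
  induction s with
  | zero => simp [jumpSum]
  | succ s ih =>
    have hms := hm (Nat.le_succ s)
    rw [jumpSum_succ]
    obtain ⟨ha, hb, h'⟩ | ⟨_, h'⟩ :=
      jump_cases (J s.unpair.1) (m s + jumpSum J m s) (jumpSum J m s) <;> rw [h']
    · set k := s.unpair.1
      set x := m s + jumpSum J m s
      have hy : (J k).2 ≤ m (s + 1) + (jumpSum J m s + ((J k).2 - x)) := by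
        simp only [x]; linarith
      have hd : Disjoint ((⋃ k, Set.Ioo ((J k).1 : ℝ) (J k).2) ∩ Set.Iio (x : ℝ))
          (Set.Ico (x : ℝ) (J k).2) := by
        rw [Set.disjoint_left]
        rintro y ⟨_, hy⟩ ⟨hy', _⟩
        exact absurd hy (not_lt.2 hy')
      have hsub : ((⋃ k, Set.Ioo ((J k).1 : ℝ) (J k).2) ∩ Set.Iio (x : ℝ)) ∪
          Set.Ico (x : ℝ) (J k).2 ⊆ (⋃ k, Set.Ioo ((J k).1 : ℝ) (J k).2) ∩
            Set.Iio ((m (s + 1) + (jumpSum J m s + ((J k).2 - x)) : ℚ) : ℝ) := by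
        have hyR : ((J k).2 : ℝ) ≤ _ := Rat.cast_le.2 hy
        have haR : ((J k).1 : ℝ) < x := Rat.cast_lt.2 ha
        have hbR : (x : ℝ) < (J k).2 := Rat.cast_lt.2 hb
        rintro y (⟨hy1, hy2⟩ | ⟨hy1, hy2⟩)
        · exact ⟨hy1, (lt_trans hy2 hbR).trans_le hyR⟩
        · exact ⟨Set.mem_iUnion.2 ⟨k, haR.trans_le hy1, hy2⟩, hy2.trans_le hyR⟩
      refine le_trans ?_ (MeasureTheory.measure_mono hsub)
      rw [MeasureTheory.measure_union hd measurableSet_Ico, Real.volume_Ico, Rat.cast_add,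
        ENNReal.ofReal_add (by exact_mod_cast jumpSum_nonneg J m s)
          (by exact_mod_cast sub_nonneg.2 hb.le), Rat.cast_sub]
      gcongr
    · refine ih.trans (MeasureTheory.measure_mono (Set.inter_subset_inter_right _
        (Set.Iio_subset_Iio (Rat.cast_le.2 ?_))))
      linarith

theorem jumpSum_le (J : ℕ → ℚ × ℚ) {m : ℕ → ℚ} (hm : Monotone m) {n : ℕ}
    (hJ : MeasureTheory.volume (⋃ k, Set.Ioo ((J k).1 : ℝ) (J k).2) ≤ 2 ^ (-(n : ℤ))) (s : ℕ) :
    jumpSum J m s ≤ (1 / 2) ^ n := by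
  have h := (ofReal_jumpSum_le J hm s).trans ((MeasureTheory.measure_mono
    Set.inter_subset_left).trans hJ)
  have h2 : (2 : ENNReal) ^ (-(n : ℤ)) = ENNReal.ofReal ((1 / 2) ^ n) := by
    rw [ENNReal.zpow_neg, zpow_natCast, one_div, inv_pow, ENNReal.ofReal_inv_of_pos (by positivity),
      ENNReal.ofReal_pow (by norm_num), ENNReal.ofReal_ofNat]
  rw [h2, ENNReal.ofReal_le_ofReal_iff (by positivity)] at h
  rw [← Rat.cast_le (K := ℝ)]
  push_cast
  exact h

theorem notMem_iUnion_of_tendsto (J : ℕ → ℚ × ℚ) {m : ℕ → ℚ} (hm : Monotone m) {x : ℝ}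
    (hx : Filter.Tendsto (fun s => ((m s + jumpSum J m s : ℚ) : ℝ)) Filter.atTop (nhds x)) :
    x ∉ ⋃ k, Set.Ioo ((J k).1 : ℝ) (J k).2 := by
  intro hmem
  obtain ⟨k, ha, hb⟩ := Set.mem_iUnion.1 hmem
  have hmono : Monotone fun s => ((m s + jumpSum J m s : ℚ) : ℝ) := fun s t hst =>
    Rat.cast_le.2 (add_le_add (hm hst) (jumpSum_monotone J m hst))
  obtain ⟨N, hN⟩ := Filter.eventually_atTop.1 (hx.eventually (lt_mem_nhds ha))
  have hs := hN (Nat.pair k N) (Nat.right_le_pair k N)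
  have hk : (Nat.pair k N).unpair.1 = k := by simp
  generalize Nat.pair k N = s at hs hk
  have h1 := jumpSum_succ J m s
  rw [hk] at h1
  have h2 := hmono.ge_of_tendsto hx
  obtain ⟨_, _, h'⟩ | ⟨h', _⟩ :=
    jump_cases (J k) (m s + jumpSum J m s) (jumpSum J m s)
  · have h3 : (J k).2 ≤ m (s + 1) + jumpSum J m (s + 1) := by
      rw [h1, h']
      linarith [hm (Nat.le_succ s)]
    exact absurd (hb.trans_le (Rat.cast_le.2 h3)) (not_lt.2 (h2 (s + 1)))
  · exact h' ⟨Rat.cast_lt.1 hs, Rat.cast_lt.1 ((h2 s).trans_lt hb)⟩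

/-- The partial function with domain `filler g` and constant value `[]`. -/
def fillerFun (g : ℕ → ℚ) : List Bool →. List Bool := fun σ =>
  ((bif inFiller g σ then some [] else none : Option (List Bool)) : Part (List Bool))

theorem partrec₂_fillerFun {P : Type*} [Primcodable P] {g : P → ℕ → ℚ} (hg : Computable₂ g) :
    Partrec₂ fun p => fillerFun (g p) :=
  Computable.ofOption (Computable.cond (computable₂_inFiller hg) (Computable.const (some []))
    (Computable.const none))

theorem fillerFun_dom (g : ℕ → ℚ) : {σ | (fillerFun g σ).Dom} = filler g := by
  ext σ
  rw [Set.mem_ofPred_eq, ← inFiller_iff, fillerFun]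
  cases inFiller g σ <;> simp

theorem primrec_unaryCode : Primrec unaryCode :=
  (Primrec.list_append.comp (Primrec.list_map Primrec.list_range
    (Primrec.const false).to₂) (Primrec.const [true])).of_eq fun k => by
      simp [unaryCode, List.map_const']

theorem mlRandom_omegaOf {U : PFMachine} (hU : UniversalPF U) : MLRandom (omegaOf U) := by
  intro I hI hvol hmem
  obtain ⟨e, he⟩ := exists_code_list U.partrec
  have H := stageApprox_haltsBy he
  let π : ℕ → List Bool := fun k => (Encodable.decode (α := List Bool) k).getD [] ++ unaryCode k
  have hπ : Computable π := by
    exact (Primrec.list_append.comp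
      (Primrec.option_getD.comp Primrec.decode (Primrec.const [])) primrec_unaryCode).to_comp
  let m : ℕ → ℕ → ℚ := fun k => mass fun s σ => !(π k).isPrefixOf σ && haltsBy e s σ
  let J : ℕ → ℕ → ℚ × ℚ := fun k => I ((π k).length + 1)
  let B : ℕ → ℕ → ℚ := fun k => jumpSum (J k) (m k)
  let g : ℕ → ℕ → ℚ := fun k s => 2 ^ (π k).length * B k s
  have Hk : ∀ k, StageApprox (fun s σ => !(π k).isPrefixOf σ && haltsBy e s σ)
      {σ | (!(π k).isPrefixOf σ) = true ∧ (U.f σ).Dom} := fun k => H.and _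
  have hD : ∀ k, PrefixFreeSet {σ | (!(π k).isPrefixOf σ) = true ∧ (U.f σ).Dom} :=
    fun k => U.prefixFree.mono fun σ h => h.2
  have hm : Computable₂ m := by
    refine computable_mass ?_
    have h1 : Computable fun y : (ℕ × ℕ) × List Bool => π y.1.1 :=
      hπ.comp (Computable.fst.comp Computable.fst)
    have h2 : Computable fun y : (ℕ × ℕ) × List Bool => haltsBy e y.1.2 y.2 :=
      (primrec_haltsBy.comp ((Primrec.const e).pair
        ((Primrec.snd.comp Primrec.fst).pair Primrec.snd))).to_comp
    exact Primrec.and.to_comp.comp (Primrec.not.to_comp.comp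
      (primrec₂_isPrefixOf.to_comp.comp h1 Computable.snd)) h2
  have hl : Computable fun k => (π k).length := Computable.list_length.comp hπ
  have hJ : Computable₂ J :=
    hI.comp (Primrec.succ.to_comp.comp (hl.comp Computable.fst)) Computable.snd
  have hg : Computable₂ g :=
    computable₂_rat_mul.comp (computable_rat_two_pow.comp (hl.comp Computable.fst))
      (computable₂_jumpSum hJ hm)
  have hmm : ∀ k, Monotone (m k) := fun k => (Hk k).mass_monotone (hD k)
  have hg0 : ∀ k s, 0 ≤ g k s := fun k s => mul_nonneg (by positivity) (jumpSum_nonneg _ _ _)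
  have hgm : ∀ k, Monotone (g k) := fun k s t hst =>
    mul_le_mul_of_nonneg_left (jumpSum_monotone _ _ hst) (by positivity)
  obtain ⟨ρ, hρ⟩ := hU (dispatchMachine _ (partrec₂_fillerFun hg) fun k => by
    rw [fillerFun_dom]; exact prefixFreeSet_filler (hg0 k) (hgm k))
  obtain ⟨k, hk⟩ : ∃ k, π k = ρ ++ unaryCode k :=
    ⟨Encodable.encode ρ, by simp only [π, Encodable.encodek, Option.getD_some]⟩
  have hdom : {τ | π k ++ τ ∈ {σ | (U.f σ).Dom}} = filler (g k) := by
    rw [← fillerFun_dom]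
    ext τ
    rw [Set.mem_ofPred_eq, Set.mem_ofPred_eq, Set.mem_ofPred_eq, hk, List.append_assoc, hρ,
      dispatchMachine_f, dispatch_unaryCode_append]
  have hBle : ∀ s, B k s ≤ (1 / 2) ^ ((π k).length + 1) :=
    jumpSum_le (J k) (hmm k) (hvol ((π k).length + 1))
  have hBm : Monotone fun s => (B k s : ℝ) := fun s t hst =>
    Rat.cast_le.2 (jumpSum_monotone _ _ hst)
  have hBle' : ∀ s, (B k s : ℝ) ≤ (1 / 2) ^ ((π k).length + 1) := fun s => by
    have := Rat.cast_le (K := ℝ).2 (hBle s)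
    push_cast at this
    exact this
  obtain ⟨b, hb⟩ : ∃ b, Filter.Tendsto (fun s => (B k s : ℝ)) Filter.atTop (nhds b) :=
    ⟨_, tendsto_atTop_ciSup hBm ⟨_, Set.forall_mem_range.2 hBle'⟩⟩
  have hble : b ≤ (1 / 2) ^ ((π k).length + 1) := le_of_tendsto' hb hBle'
  have hone : (2 : ℝ) ^ (π k).length * (1 / 2) ^ (π k).length = 1 := by
    rw [← mul_pow]; norm_num
  have hgt : Filter.Tendsto (fun s => (g k s : ℝ)) Filter.atTop
      (nhds (2 ^ (π k).length * b)) := by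
    refine (hb.const_mul _).congr fun s => ?_
    simp only [g, Rat.cast_mul, Rat.cast_pow, Rat.cast_ofNat]
  have hg1 : (2 : ℝ) ^ (π k).length * b ≤ 1 := by
    calc (2 : ℝ) ^ (π k).length * b ≤ 2 ^ (π k).length * (1 / 2) ^ ((π k).length + 1) :=
          mul_le_mul_of_nonneg_left hble (by positivity)
      _ ≤ 1 := by rw [pow_succ, ← mul_assoc, hone]; norm_num
  have hg00 : g k 0 < 1 := by
    have : g k 0 = 0 := mul_zero _
    rw [this]; exact one_pos
  have hΩ : omegaOf U = b + ∑' σ, wt {σ | (!(π k).isPrefixOf σ) = true ∧ (U.f σ).Dom} σ := by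
    rw [omegaOf_eq, tsum_wt_split (fun σ => π k <+: σ) U.prefixFree, tsum_wt_cone, hdom,
      tsum_wt_filler (hg0 k) (hgm k) hg00 hgt hg1, ← mul_assoc, mul_comm ((1 / 2 : ℝ) ^ _), hone,
      one_mul]
    congr 4
    ext σ
    simp [← List.isPrefixOf_iff_prefix]
  have hlim : Filter.Tendsto (fun s => ((m k s + B k s : ℚ) : ℝ)) Filter.atTop
      (nhds (omegaOf U)) := by
    rw [hΩ, add_comm]
    refine (((Hk k).tendsto_mass (hD k)).add hb).congr fun s => ?_
    rw [Rat.cast_add]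
  exact notMem_iUnion_of_tendsto (J k) (hmm k) hlim (Set.mem_iInter.1 hmem _)

/-- The greatest sequence below `r β` which grows no faster than `a`. -/
def slowed (a β : ℕ → ℚ) (r : ℚ) (s : ℕ) : ℚ :=
  Nat.rec 0 (fun t W => min (r * β (t + 1)) (W + (a (t + 1) - a t))) s

theorem slowed_succ (a β : ℕ → ℚ) (r : ℚ) (s : ℕ) :
    slowed a β r (s + 1) = min (r * β (s + 1)) (slowed a β r s + (a (s + 1) - a s)) := rfl

theorem computable₂_slowed {a β r : ℕ → ℚ} (ha : Computable a) (hβ : Computable β)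
    (hr : Computable r) : Computable₂ fun n s => slowed a β (r n) s := by
  have ht : Computable fun y : (ℕ × ℕ) × ℕ × ℚ => y.2.1 := Computable.fst.comp Computable.snd
  have ht' : Computable fun y : (ℕ × ℕ) × ℕ × ℚ => y.2.1 + 1 := Computable.succ.comp ht
  have hr' : Computable fun y : (ℕ × ℕ) × ℕ × ℚ => r y.1.1 :=
    hr.comp (Computable.fst.comp Computable.fst)
  have hs : Computable₂ fun (p : ℕ × ℕ) (x : ℕ × ℚ) =>
      min (r p.1 * β (x.1 + 1)) (x.2 + (a (x.1 + 1) - a x.1)) :=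
    computable₂_rat_min.comp (computable₂_rat_mul.comp hr' (hβ.comp ht'))
      (computable₂_rat_add.comp (Computable.snd.comp Computable.snd)
        (computable₂_rat_sub.comp (ha.comp ht') (ha.comp ht)))
  exact Computable.nat_rec Computable.snd (Computable.const 0) hs

section Slowed

variable {a β : ℕ → ℚ} {r : ℚ}

theorem slowed_le (hβ0 : β 0 = 0) (s : ℕ) : slowed a β r s ≤ r * β s := by
  cases s with
  | zero => rw [hβ0, mul_zero]; exact le_rfl
  | succ s => exact min_le_left _ _

theorem sub_slowed_monotone : Monotone fun s => a s - slowed a β r s := by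
  refine monotone_nat_of_le_succ fun s => ?_
  have : slowed a β r (s + 1) ≤ slowed a β r s + (a (s + 1) - a s) := min_le_right _ _
  linarith

theorem sub_slowed_nonneg (ha : 0 ≤ a 0) (s : ℕ) : 0 ≤ a s - slowed a β r s :=
  le_trans (by simpa [slowed] using ha) (sub_slowed_monotone (Nat.zero_le s))

/-- The interval that the sum of `a - slowed a β r` and `r β` crosses between stages `s` and
`s + 1` when `slowed a β r` does not catch up. -/
def gap (a β : ℕ → ℚ) (r : ℚ) (s : ℕ) : ℚ × ℚ :=
  (a s - slowed a β r s + r * β s - r * (1 / 2) ^ (s + 1),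
    a s - slowed a β r s + r * β (s + 1))

theorem add_le_of_notMem_gap {α : ℝ} (hr : 0 < r) (hβ0 : β 0 = 0) (ha : ∀ s, (a s : ℝ) ≤ α)
    (hα : α ∉ ⋃ s, Set.Ioo ((gap a β r s).1 : ℝ) (gap a β r s).2) (s : ℕ) :
    ((a s - slowed a β r s + r * β s : ℚ) : ℝ) ≤ α := by
  induction s with
  | zero => simpa [slowed, hβ0] using ha 0
  | succ s ih =>
    rw [slowed_succ]
    rcases min_choice (r * β (s + 1)) (slowed a β r s + (a (s + 1) - a s)) with h | h <;> rw [h]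
    · simpa using ha (s + 1)
    · by_contra hlt
      refine hα (Set.mem_iUnion.2 ⟨s, lt_of_lt_of_le (Rat.cast_lt.2 ?_) ih, ?_⟩)
      · have : 0 < r * (1 / 2) ^ (s + 1) := by positivity
        rw [gap]; linarith
      · have h2 : (gap a β r s).2 =
            a (s + 1) - (slowed a β r s + (a (s + 1) - a s)) + r * β (s + 1) := by
          rw [gap]; ring
        rw [h2]
        exact not_le.1 hlt

theorem tendsto_sub_slowed {α b : ℝ} (hr : 0 < r) (hβ0 : β 0 = 0) (ha : Monotone a)
    (haα : Filter.Tendsto (fun s => (a s : ℝ)) Filter.atTop (nhds α))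
    (hβ : Filter.Tendsto (fun s => (β s : ℝ)) Filter.atTop (nhds b))
    (hα : α ∉ ⋃ s, Set.Ioo ((gap a β r s).1 : ℝ) (gap a β r s).2) :
    Filter.Tendsto (fun s => ((a s - slowed a β r s : ℚ) : ℝ)) Filter.atTop
      (nhds (α - r * b)) := by
  have haR : Monotone fun s => (a s : ℝ) := fun s t h => Rat.cast_le.2 (ha h)
  have h1 := add_le_of_notMem_gap hr hβ0 (haR.ge_of_tendsto haα) hα
  have h2 : ∀ s, (a s : ℝ) ≤ ((a s - slowed a β r s + r * β s : ℚ) : ℝ) := fun s =>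
    Rat.cast_le.2 (by linarith [slowed_le (a := a) (r := r) hβ0 s])
  have h3 := tendsto_of_tendsto_of_tendsto_of_le_of_le haα tendsto_const_nhds h2 h1
  refine (h3.sub (hβ.const_mul (r : ℝ))).congr fun s => ?_
  push_cast
  ring

theorem volume_gap_le (hr : 0 ≤ r) (hβ0 : β 0 = 0) (hβm : Monotone β) (hβ1 : ∀ s, β s ≤ 1) :
    MeasureTheory.volume (⋃ s, Set.Ioo ((gap a β r s).1 : ℝ) (gap a β r s).2) ≤
      ENNReal.ofReal ((2 * r : ℚ) : ℝ) := by
  have hgap : ∀ s, (gap a β r s).2 - (gap a β r s).1 =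
      r * (1 / 2) ^ (s + 1) + r * (β (s + 1) - β s) := fun s => by rw [gap]; ring
  have h0 : ∀ s, 0 ≤ (gap a β r s).2 - (gap a β r s).1 := fun s => by
    rw [hgap]
    exact add_nonneg (by positivity) (mul_nonneg hr (sub_nonneg.2 (hβm (Nat.le_succ s))))
  have hsum : ∀ n, ∑ s ∈ Finset.range n, ((gap a β r s).2 - (gap a β r s).1) =
      r * (1 - (1 / 2) ^ n) + r * β n := by
    intro n
    induction n with
    | zero => simp [hβ0]
    | succ n ih => rw [Finset.sum_range_succ, ih, hgap, pow_succ]; ring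
  refine (MeasureTheory.measure_iUnion_le _).trans (ENNReal.tsum_le_of_sum_range_le fun n => ?_)
  simp only [Real.volume_Ioo, ← Rat.cast_sub]
  rw [← ENNReal.ofReal_sum_of_nonneg fun s _ => by exact_mod_cast h0 s, ← Rat.cast_sum, hsum]
  refine ENNReal.ofReal_le_ofReal (Rat.cast_le.2 ?_)
  have h1 := mul_le_mul_of_nonneg_left (hβ1 n) hr
  have h2 : 0 ≤ r * (1 / 2) ^ n := by positivity
  linarith

end Slowed

theorem computable₂_gap {a β r : ℕ → ℚ} (ha : Computable a) (hβ : Computable β)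
    (hr : Computable r) : Computable₂ fun n s => gap a β (r n) s := by
  have hs : Computable fun y : ℕ × ℕ => y.2 + 1 := Computable.succ.comp Computable.snd
  have hr' : Computable fun y : ℕ × ℕ => r y.1 := hr.comp Computable.fst
  have h1 : Computable fun y : ℕ × ℕ => a y.2 - slowed a β (r y.1) y.2 :=
    computable₂_rat_sub.comp (ha.comp Computable.snd) (computable₂_slowed ha hβ hr)
  exact Computable.pair
    (computable₂_rat_sub.comp
      (computable₂_rat_add.comp h1 (computable₂_rat_mul.comp hr' (hβ.comp Computable.snd)))
      (computable₂_rat_mul.comp hr' (computable_rat_half_pow.comp hs)))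
    (computable₂_rat_add.comp h1 (computable₂_rat_mul.comp hr' (hβ.comp hs)))

theorem cylLeft_replicate_true (c : ℕ) : cylLeft (List.replicate c true) = 1 - (1 / 2) ^ c := by
  induction c with
  | zero => simp [cylLeft]
  | succ c ih => rw [List.replicate_succ, cylLeft, ih, if_pos rfl, pow_succ]; ring

/-- Runs `U` on the cone above `1ᶜ` and fills up the rest with the strings of `filler g`. -/
theorem exists_universal_of_tendsto {U : PFMachine} (hU : UniversalPF U) {g : ℕ → ℚ} {γ : ℝ}
    (c : ℕ) (hg : Computable g) (h0 : ∀ s, 0 ≤ g s) (hm : Monotone g)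
    (hγ : Filter.Tendsto (fun s => (g s : ℝ)) Filter.atTop (nhds γ)) (hc : γ ≤ 1 - (1 / 2) ^ c) :
    ∃ V : PFMachine, UniversalPF V ∧ omegaOf V = (1 / 2) ^ c * omegaOf U + γ := by
  let π := List.replicate c true
  let F : List Bool →. List Bool := fun σ =>
    bif π.isPrefixOf σ then U.f (σ.drop c) else fillerFun g σ
  have hFπ : ∀ σ, F (π ++ σ) = U.f σ := fun σ => by
    have h : π.isPrefixOf (π ++ σ) = true :=
      List.isPrefixOf_iff_prefix.2 (List.prefix_append _ _)
    simp only [F, h, cond_true]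
    rw [List.drop_left' (List.length_replicate ..)]
  have hFn : ∀ σ, ¬ π <+: σ → F σ = fillerFun g σ := fun σ hσ => by
    have h : π.isPrefixOf σ = false := by
      rw [Bool.eq_false_iff, ne_eq, List.isPrefixOf_iff_prefix]; exact hσ
    simp only [F, h, cond_false]
  have hmem : ∀ σ, (fillerFun g σ).Dom ↔ σ ∈ filler g := fun σ => by rw [← fillerFun_dom]; rfl
  have hpos : (0 : ℝ) < (1 / 2) ^ c := by positivity
  have hg1 : g 0 < 1 := by
    have hgR : Monotone fun s => (g s : ℝ) := fun s t h => Rat.cast_le.2 (hm h)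
    have := hgR.ge_of_tendsto hγ 0
    rw [← Rat.cast_lt (K := ℝ), Rat.cast_one]
    linarith
  have hcone : ∀ σ τ, σ ∈ filler g → σ <+: τ → ¬ π <+: τ := by
    intro σ τ hσ hστ hπ
    have h1 : (cylLeft τ : ℝ) ∈ Set.Ico 0 γ := by
      rw [← iUnion_cyl_filler h0 hm hg1 hγ (by linarith)]
      exact Set.mem_biUnion hσ (cyl_subset_of_prefix hστ (cylLeft_mem_cyl τ))
    have h2 := (cyl_subset_of_prefix hπ (cylLeft_mem_cyl τ)).1
    rw [cylLeft_replicate_true] at h2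
    push_cast at h2
    linarith [h1.2]
  let V : PFMachine :=
    { f := F
      partrec := by
        have h1 : Computable fun σ : List Bool => π.isPrefixOf σ :=
          (primrec₂_isPrefixOf.comp (Primrec.const π) Primrec.id).to_comp
        have h2 : Computable fun σ : List Bool => σ.drop c :=
          (Primrec.list_drop.comp (Primrec.const c) Primrec.id).to_comp
        have h3 : Partrec₂ fun _ : ℕ => fillerFun g :=
          partrec₂_fillerFun (hg.comp Computable.snd)
        exact Partrec.cond h1 (U.partrec.comp h2) (h3.comp (Computable.const 0) Computable.id)
      prefixFree := by
        intro σ hσ τ hτ h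
        rw [Set.mem_ofPred_eq] at hσ hτ
        by_cases hπσ : π <+: σ
        · obtain ⟨σ, rfl⟩ := hπσ
          obtain ⟨τ, rfl⟩ := (List.prefix_append π σ).trans h
          rw [hFπ] at hσ hτ
          rw [U.prefixFree σ hσ τ hτ ((List.prefix_append_right_inj π).1 h)]
        · rw [hFn σ hπσ, hmem] at hσ
          have hπτ := hcone σ τ hσ h
          rw [hFn τ hπτ, hmem] at hτ
          exact prefixFreeSet_filler h0 hm σ hσ τ hτ h }
  refine ⟨V, fun M => ?_, ?_⟩
  · obtain ⟨ρ, hρ⟩ := hU M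
    exact ⟨π ++ ρ, fun σ => by rw [← hρ, List.append_assoc]; exact hFπ _⟩
  · have h1 : {τ | π ++ τ ∈ {σ | (V.f σ).Dom}} = {σ | (U.f σ).Dom} := by
      ext σ
      exact iff_of_eq (congrArg Part.Dom (hFπ σ))
    have h2 : {σ | ¬ π <+: σ ∧ σ ∈ {σ | (V.f σ).Dom}} = filler g := by
      ext σ
      constructor
      · rintro ⟨hn, hd⟩
        rw [← hmem, ← hFn σ hn]
        exact hd
      · intro hσ
        have hn := hcone σ σ hσ (List.prefix_refl σ)
        refine ⟨hn, ?_⟩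
        rw [← hmem, ← hFn σ hn] at hσ
        exact hσ
    rw [omegaOf_eq V, tsum_wt_split (fun σ => π <+: σ) V.prefixFree, tsum_wt_cone, h1, h2,
      tsum_wt_filler h0 hm hg1 hγ (by linarith), ← omegaOf_eq, List.length_replicate]

theorem exists_universal_of_mlRandom {α : ℝ} (h1 : α ∈ Set.Ioo (0 : ℝ) 1) (h2 : LeftCE α)
    (hα : MLRandom α) : ∃ U : PFMachine, UniversalPF U ∧ omegaOf U = α := by
  obtain ⟨q, hq, hqm, hqα⟩ := h2
  obtain ⟨U, hU⟩ := exists_universal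
  obtain ⟨e, he⟩ := exists_code_list U.partrec
  have H := stageApprox_haltsBy he
  obtain ⟨k, hk⟩ := exists_pow_lt_of_lt_one (sub_pos.2 h1.2) (by norm_num : (1 / 2 : ℝ) < 1)
  let a : ℕ → ℚ := fun s => max (q s) 0
  let β := mass (haltsBy e)
  let r : ℕ → ℚ := fun n => (1 / 2) ^ (n + k + 1)
  have ha : Computable a := computable₂_rat_max.comp hq (Computable.const 0)
  have ham : Monotone a := fun s t h => max_le_max (hqm h) le_rfl
  have haα : Filter.Tendsto (fun s => (a s : ℝ)) Filter.atTop (nhds α) := by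
    have := hqα.max (tendsto_const_nhds (x := (0 : ℝ)))
    rw [max_eq_left h1.1.le] at this
    refine this.congr fun s => ?_
    simp only [a, Rat.cast_max, Rat.cast_zero]
  have hβ : Computable β := by
    have : Computable₂ fun (_ : ℕ) s => mass (haltsBy e) s :=
      computable_mass (primrec_haltsBy.comp ((Primrec.const e).pair
        ((Primrec.snd.comp Primrec.fst).pair Primrec.snd))).to_comp
    exact this.comp (Computable.const 0) Computable.id
  have hβlim : Filter.Tendsto (fun s => (β s : ℝ)) Filter.atTop (nhds (omegaOf U)) := by
    rw [omegaOf_eq]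
    exact H.tendsto_mass U.prefixFree
  have hβm : Monotone β := H.mass_monotone U.prefixFree
  have hr : Computable r := by
    refine computable_rat_half_pow.comp (Primrec.to_comp ?_)
    exact Primrec.succ.comp (Primrec.nat_add.comp Primrec.id (Primrec.const k))
  have hr0 : ∀ n, 0 < r n := fun n => by positivity
  obtain ⟨n, hn⟩ : ∃ n, α ∉ ⋃ s, Set.Ioo ((gap a β (r n) s).1 : ℝ) (gap a β (r n) s).2 := by
    by_contra! hmem
    refine hα (fun n s => gap a β (r n) s) (computable₂_gap ha hβ hr) (fun n => ?_)
      (Set.mem_iInter.2 hmem)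
    refine (volume_gap_le (hr0 n).le (mass_zero _) hβm (H.mass_le_one U.prefixFree)).trans ?_
    have h3 : (2 : ENNReal) ^ (-(n : ℤ)) = ENNReal.ofReal ((1 / 2) ^ n) := by
      rw [ENNReal.zpow_neg, zpow_natCast, one_div, inv_pow,
        ENNReal.ofReal_inv_of_pos (by positivity), ENNReal.ofReal_pow (by norm_num),
        ENNReal.ofReal_ofNat]
    rw [h3]
    refine ENNReal.ofReal_le_ofReal ?_
    simp only [r]
    push_cast
    rw [pow_succ, pow_add]
    have : ((1 / 2 : ℝ)) ^ k ≤ 1 := pow_le_one₀ (by norm_num) (by norm_num)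
    have h4 : (1 / 2 : ℝ) ^ n * (1 / 2) ^ k ≤ (1 / 2) ^ n * 1 := by gcongr
    linarith
  have hlim := tendsto_sub_slowed (hr0 n) (mass_zero _) ham haα hβlim hn
  have hΩ0 : 0 ≤ omegaOf U := by
    rw [omegaOf_eq]
    exact tsum_nonneg (wt_nonneg _)
  have hg : Computable fun s => a s - slowed a β (r n) s :=
    computable₂_rat_sub.comp ha
      ((computable₂_slowed ha hβ hr).comp (Computable.const n) Computable.id)
  have hrR : (r n : ℝ) = (1 / 2) ^ (n + k + 1) := by simp only [r]; push_cast; rfl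
  have hle : α - r n * omegaOf U ≤ 1 - (1 / 2) ^ (n + k + 1) := by
    have h3 : (1 / 2 : ℝ) ^ (n + k + 1) ≤ (1 / 2) ^ k :=
      pow_le_pow_of_le_one (by norm_num) (by norm_num) (by omega)
    have h4 : 0 ≤ (r n : ℝ) * omegaOf U := mul_nonneg (by exact_mod_cast (hr0 n).le) hΩ0
    linarith
  obtain ⟨V, hV, hVα⟩ := exists_universal_of_tendsto hU (n + k + 1) hg
    (sub_slowed_nonneg (le_max_right _ _)) sub_slowed_monotone hlim hle
  exact ⟨V, hV, by rw [hVα, hrR]; ring⟩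

/-- A left-c.e. real α in (0,1) is Martin-Löf random iff there is a
universal prefix-free machine U with Ω_U = α. -/
theorem stmt_3 (α : ℝ) (h1 : α ∈ Set.Ioo (0:ℝ) 1) (h2 : LeftCE α) :
    MLRandom α ↔ ∃ U : PFMachine, UniversalPF U ∧ omegaOf U = α :=
  ⟨exists_universal_of_mlRandom h1 h2, by
    rintro ⟨U, hU, rfl⟩
    exact mlRandom_omegaOf hU⟩
end

section
/- For left-c.e. reals α and β, the following are equivalent: (i) α ≤_S β; (ii) there is a positive rational q such that qβ − α is left-c.e.; (iii) there are a positive rational q and computable nondecreasing rational sequences (α_s) → α and (β_s) → β with α − α_s ≤ q·(β − β_s) for all s; (iv) there are a positive rational q and computable nondecreasing rational sequences (α_s) → α and (β_s) → β with α_{s+1} − α_s ≤ q·(β_{s+1} − β_s) for all s. -/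
open scoped Classical

open Encodable

namespace Rat

/-- The code of a rational as a pair of codes of its numerator and denominator. -/
abbrev pairCode (q : ℚ) : ℕ := @encode ℚ Rat.instEncodable q

theorem pairCode_eq (q : ℚ) : pairCode q = Nat.pair (encode q.num) q.den := rfl

theorem pairCode_ofNat_eq :
    ∃ (_ : DecidablePred (· ∈ Set.range pairCode)) (_ : Infinite (Set.range pairCode)),
      ∀ n, pairCode (Denumerable.ofNat ℚ n) = (Nat.Subtype.ofNat (Set.range pairCode) n : ℕ) := by
  refine ⟨decidableRangeEncode ℚ,
    Infinite.of_injective _ (Equiv.ofInjective _ encode_injective).injective, fun n => ?_⟩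
  let := decidableRangeEncode ℚ
  let : Infinite (Set.range pairCode) :=
    Infinite.of_injective _ (Equiv.ofInjective _ encode_injective).injective
  let := Nat.Subtype.denumerable (Set.range pairCode)
  have h₁ : Denumerable.ofNat ℚ n = (equivRangeEncode ℚ).symm
      (Denumerable.ofNat (Set.range pairCode) n) :=
    Denumerable.ofEquiv_ofNat _ (equivRangeEncode ℚ) n
  have h₂ : Denumerable.ofNat (Set.range pairCode) n = Nat.Subtype.ofNat _ n :=
    Denumerable.ofEquiv_ofNat ℕ _ n
  rw [h₁, h₂]
  exact congrArg Subtype.val (Equiv.apply_symm_apply (equivRangeEncode ℚ) _)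

theorem _root_.Int.encode_eq_ite (z : ℤ) :
    encode z = if 0 ≤ z then 2 * z.toNat else 2 * (-z).toNat - 1 := by
  rcases z with n | n
  · simp; rfl
  · have : encode (Int.negSucc n) = 2 * n + 1 := rfl
    rw [this, if_neg (by simp)]
    simp only [Int.neg_negSucc]
    have : (n.succ : ℤ).toNat = n + 1 := rfl
    omega

/-- The absolute value of the integer with code `e`. -/
def codeNatAbs (e : ℕ) : ℕ := (e + 1) / 2

theorem codeNatAbs_encode (z : ℤ) : codeNatAbs (encode z) = z.natAbs := by
  rw [Int.encode_eq_ite, codeNatAbs]; split <;> omega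

theorem mem_range_pairCode (n : ℕ) : n ∈ Set.range pairCode ↔
    0 < n.unpair.2 ∧ (codeNatAbs n.unpair.1).Coprime n.unpair.2 := by
  constructor
  · rintro ⟨q, rfl⟩
    rw [pairCode_eq, Nat.unpair_pair]
    exact ⟨q.pos, by rw [codeNatAbs_encode]; exact q.reduced⟩
  · rintro ⟨h₁, h₂⟩
    have h := Denumerable.encode_ofNat (α := ℤ) n.unpair.1
    refine ⟨⟨Denumerable.ofNat ℤ n.unpair.1, n.unpair.2, h₁.ne', ?_⟩, ?_⟩
    · rw [← codeNatAbs_encode]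
      exact h.symm ▸ h₂
    · rw [pairCode_eq]
      exact (congrArg (Nat.pair · _) h).trans (Nat.pair_unpair n)

end Rat

theorem Nat.coprime_iff_forall_lt {a b : ℕ} (hb : 0 < b) :
    a.Coprime b ↔ ∀ d < b + 1, a % d = 0 → b % d = 0 → d = 1 := by
  constructor
  · intro h d _ ha hb
    exact Nat.eq_one_of_dvd_coprimes h (Nat.dvd_of_mod_eq_zero ha) (Nat.dvd_of_mod_eq_zero hb)
  · intro h
    exact h _ (Nat.lt_succ_of_le (Nat.gcd_le_right _ hb))
      (Nat.mod_eq_zero_of_dvd (Nat.gcd_dvd_left _ _))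
      (Nat.mod_eq_zero_of_dvd (Nat.gcd_dvd_right _ _))

namespace Rat

theorem primrecPred_range_pairCode : PrimrecPred (· ∈ Set.range pairCode) := by
  have h₁ : Primrec fun n : ℕ => codeNatAbs n.unpair.1 :=
    Primrec.nat_div.comp (Primrec.succ.comp (Primrec.fst.comp Primrec.unpair)) (Primrec.const 2)
  have h₂ : Primrec fun n : ℕ => n.unpair.2 := Primrec.snd.comp Primrec.unpair
  have hdvd : ∀ {f : ℕ → ℕ}, Primrec f → PrimrecPred fun p : ℕ × ℕ => f p.2 % p.1 = 0 := fun hf =>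
    Primrec.eq.comp (Primrec.nat_mod.comp (hf.comp Primrec.snd) Primrec.fst) (Primrec.const 0)
  have h₃ : PrimrecRel fun d n : ℕ =>
      ¬ codeNatAbs n.unpair.1 % d = 0 ∨ ¬ n.unpair.2 % d = 0 ∨ d = 1 :=
    (hdvd h₁).not.or ((hdvd h₂).not.or (Primrec.eq.comp Primrec.fst (Primrec.const 1)))
  refine ((Primrec.nat_lt.comp (Primrec.const 0) h₂).and
    (h₃.forall_lt.comp (Primrec.succ.comp h₂) Primrec.id)).of_eq fun n => ?_
  rw [mem_range_pairCode]
  refine and_congr_right fun h => ?_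
  rw [Nat.coprime_iff_forall_lt h]
  simp only [id, imp_iff_not_or, Nat.succ_eq_add_one]

theorem computable_pairCode : Computable pairCode := by
  obtain ⟨_, _, h⟩ := pairCode_ofNat_eq
  have hex : ∀ x : ℕ, ∃ y, x < y ∧ y ∈ Set.range pairCode := fun x => by
    obtain ⟨y, hy, hxy⟩ := (Set.infinite_coe_iff.1 ‹Infinite (Set.range pairCode)›).exists_gt x
    exact ⟨y, hxy, hy⟩
  have hnext : Computable fun x => Nat.find (hex x) :=
    Computable.find ((Primrec.nat_lt.and
      (primrecPred_range_pairCode.comp Primrec.snd)).computablePred) hex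
  have hsucc : ∀ x : Set.range pairCode, (Nat.Subtype.succ x : ℕ) = Nat.find (hex x) := by
    intro x
    apply le_antisymm
    · have := Nat.find_spec (hex x)
      exact Nat.Subtype.succ_le_of_lt (x := ⟨_, this.2⟩) this.1
    · exact Nat.find_min' _ ⟨Nat.Subtype.lt_succ_self x, (Nat.Subtype.succ x).2⟩
  have hrec := Computable.nat_rec Computable.encode
    (Computable.const (α := ℚ) (pairCode (Denumerable.ofNat ℚ 0)))
    (hnext.comp (Computable.snd.comp Computable.snd)).to₂
  refine hrec.of_eq fun q => ?_
  have key : ∀ n : ℕ, Nat.rec (motive := fun _ => ℕ) (pairCode (Denumerable.ofNat ℚ 0))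
      (fun _ x => Nat.find (hex x)) n = pairCode (Denumerable.ofNat ℚ n) := by
    intro n
    induction n with
    | zero => rfl
    | succ n ih =>
      simp only [ih]
      rw [h (n + 1), Nat.Subtype.ofNat, hsucc]
      congr 1
      funext y
      rw [h n]
  refine (key _).trans ?_
  rw [Denumerable.ofNat_encode]

theorem computable_den : Computable Rat.den :=
  (Computable.snd.comp (Computable.unpair.comp computable_pairCode)).of_eq fun q => by
    rw [pairCode_eq, Nat.unpair_pair]

theorem computable_encode_num : Computable fun q : ℚ => encode q.num :=
  (Computable.fst.comp (Computable.unpair.comp computable_pairCode)).of_eq fun q => by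
    rw [pairCode_eq, Nat.unpair_pair]

/-- The positive part of the numerator of a rational. -/
def posNum (q : ℚ) : ℕ := q.num.toNat

/-- The negative part of the numerator of a rational. -/
def negNum (q : ℚ) : ℕ := (-q.num).toNat

theorem computable_posNum : Computable posNum := by
  have h : Primrec fun e : ℕ => if e % 2 = 0 then e / 2 else 0 :=
    Primrec.ite (Primrec.eq.comp (Primrec.nat_mod.comp Primrec.id (Primrec.const 2))
      (Primrec.const 0)) (Primrec.nat_div.comp Primrec.id (Primrec.const 2)) (Primrec.const 0)
  refine (h.to_comp.comp computable_encode_num).of_eq fun q => ?_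
  simp only [Int.encode_eq_ite, posNum]
  split_ifs <;> omega

theorem computable_negNum : Computable negNum := by
  have h : Primrec fun e : ℕ => if e % 2 = 0 then 0 else (e + 1) / 2 :=
    Primrec.ite (Primrec.eq.comp (Primrec.nat_mod.comp Primrec.id (Primrec.const 2))
      (Primrec.const 0)) (Primrec.const 0)
      (Primrec.nat_div.comp (Primrec.succ.comp Primrec.id) (Primrec.const 2))
  refine (h.to_comp.comp computable_encode_num).of_eq fun q => ?_
  simp only [Int.encode_eq_ite, negNum]
  split_ifs <;> omega

theorem mul_den_eq_posNum_sub_negNum (q : ℚ) : q * q.den = (q.posNum : ℚ) - q.negNum := by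
  rw [Rat.mul_den_eq_num]
  exact_mod_cast (Int.toNat_sub_toNat_neg q.num).symm

theorem add_eq_iff_nat (x y z : ℚ) :
    x.posNum * (y.den * z.den) + y.posNum * (x.den * z.den) + z.negNum * (x.den * y.den) =
      x.negNum * (y.den * z.den) + y.negNum * (x.den * z.den) + z.posNum * (x.den * y.den) ↔
    x + y = z := by
  have ex := x.mul_den_eq_posNum_sub_negNum
  have ey := y.mul_den_eq_posNum_sub_negNum
  have ez := z.mul_den_eq_posNum_sub_negNum
  have h : (x.den * y.den * z.den : ℚ) ≠ 0 := by simp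
  rw [← Nat.cast_inj (R := ℚ), ← sub_eq_zero, ← sub_eq_zero (b := z),
    ← mul_eq_zero_iff_right (a := x + y - z) h]
  push_cast
  apply Eq.congr_left
  linear_combination (-y.den * z.den : ℚ) * ex - x.den * z.den * ey + x.den * y.den * ez

theorem mul_eq_iff_nat (x y z : ℚ) :
    (x.posNum * y.posNum + x.negNum * y.negNum) * z.den + z.negNum * (x.den * y.den) =
      (x.posNum * y.negNum + x.negNum * y.posNum) * z.den + z.posNum * (x.den * y.den) ↔
    x * y = z := by
  have ex := x.mul_den_eq_posNum_sub_negNum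
  have ey := y.mul_den_eq_posNum_sub_negNum
  have ez := z.mul_den_eq_posNum_sub_negNum
  have h : (x.den * y.den * z.den : ℚ) ≠ 0 := by simp
  rw [← Nat.cast_inj (R := ℚ), ← sub_eq_zero, ← sub_eq_zero (b := z),
    ← mul_eq_zero_iff_right (a := x * y - z) h]
  push_cast
  apply Eq.congr_left
  linear_combination (-y.den * z.den * y : ℚ) * ex -
    (x.posNum - x.negNum : ℚ) * z.den * ey + x.den * y.den * ez

theorem inv_natCast_eq_iff_nat (n : ℕ) (z : ℚ) :
    z.posNum * (n + 1) = z.den + z.negNum * (n + 1) ↔ ((n + 1 : ℕ) : ℚ)⁻¹ = z := by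
  have ez := z.mul_den_eq_posNum_sub_negNum
  have hn : ((n + 1 : ℕ) : ℚ) ≠ 0 := by positivity
  have hd : (z.den : ℚ) ≠ 0 := by simp
  rw [eq_comm (b := z), ← mul_eq_one_iff_eq_inv₀ hn, ← Nat.cast_inj (R := ℚ), ← sub_eq_zero,
    ← sub_eq_zero (b := (1 : ℚ)), ← mul_eq_zero_iff_right (a := z * _ - 1) hd]
  push_cast
  apply Eq.congr_left
  linear_combination -(n + 1 : ℚ) * ez

theorem le_iff_nat (x y : ℚ) :
    x.posNum * y.den + y.negNum * x.den ≤ y.posNum * x.den + x.negNum * y.den ↔ x ≤ y := by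
  have ex := x.mul_den_eq_posNum_sub_negNum
  have ey := y.mul_den_eq_posNum_sub_negNum
  have h : (0 : ℚ) < x.den * y.den := by exact_mod_cast Nat.mul_pos x.pos y.pos
  rw [← Nat.cast_le (α := ℚ), ← mul_le_mul_iff_left₀ (b := x) h, ← sub_nonneg,
    ← sub_nonneg (b := x * _)]
  push_cast
  have : (y.posNum * x.den + x.negNum * y.den : ℚ) - (x.posNum * y.den + y.negNum * x.den) =
      y * (x.den * y.den) - x * (x.den * y.den) := by
    linear_combination (y.den : ℚ) * ex - (x.den : ℚ) * ey
  rw [this]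

end Rat

theorem Computable.of_graph {α σ : Type*} [Primcodable α] [Denumerable σ] {f : α → σ}
    (hf : ComputablePred fun p : α × σ => f p.1 = p.2) : Computable f := by
  classical
  have hP : ComputablePred fun p : α × ℕ => f p.1 = Denumerable.ofNat σ p.2 := by
    refine Computable.computablePred ?_
    exact (hf.decide.comp (Computable.pair Computable.fst
      ((Computable.ofNat σ).comp Computable.snd)))
  have hex : ∀ a, ∃ n, f a = Denumerable.ofNat σ n := fun a =>
    ⟨encode (f a), (Denumerable.ofNat_encode _).symm⟩
  exact ((Computable.ofNat σ).comp (Computable.find hP hex)).of_eq fun a =>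
    (Nat.find_spec (hex a)).symm

theorem ComputablePred.comp {α β : Type*} [Primcodable α] [Primcodable β] {p : β → Prop}
    {f : α → β} (hp : ComputablePred p) (hf : Computable f) : ComputablePred fun a => p (f a) := by
  classical
  exact Computable.computablePred (hp.decide.comp hf)

namespace Computable

variable {α : Type*} [Primcodable α]

theorem nat_eq {f g : α → ℕ} (hf : Computable f) (hg : Computable g) :
    ComputablePred fun a => f a = g a :=
  (Primrec.eq (α := ℕ)).computablePred.comp (hf.pair hg)

theorem nat_le {f g : α → ℕ} (hf : Computable f) (hg : Computable g) :
    ComputablePred fun a => f a ≤ g a :=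
  Primrec.nat_le.computablePred.comp (hf.pair hg)

theorem nat_add {f g : α → ℕ} (hf : Computable f) (hg : Computable g) :
    Computable fun a => f a + g a :=
  Primrec.nat_add.to_comp.comp hf hg

theorem nat_mul {f g : α → ℕ} (hf : Computable f) (hg : Computable g) :
    Computable fun a => f a * g a :=
  Primrec.nat_mul.to_comp.comp hf hg

theorem _root_.Rat.computable₂_add : Computable₂ fun x y : ℚ => x + y := by
  have hx : Computable fun p : (ℚ × ℚ) × ℚ => p.1.1 := fst.comp fst
  have hy : Computable fun p : (ℚ × ℚ) × ℚ => p.1.2 := snd.comp fst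
  have hz : Computable fun p : (ℚ × ℚ) × ℚ => p.2 := snd
  have dx := Rat.computable_den.comp hx
  have dy := Rat.computable_den.comp hy
  have dz := Rat.computable_den.comp hz
  have px := Rat.computable_posNum.comp hx
  have py := Rat.computable_posNum.comp hy
  have pz := Rat.computable_posNum.comp hz
  have nx := Rat.computable_negNum.comp hx
  have ny := Rat.computable_negNum.comp hy
  have nz := Rat.computable_negNum.comp hz
  have h : ComputablePred fun p : (ℚ × ℚ) × ℚ =>
      p.1.1.posNum * (p.1.2.den * p.2.den) + p.1.2.posNum * (p.1.1.den * p.2.den) +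
            p.2.negNum * (p.1.1.den * p.1.2.den) =
          p.1.1.negNum * (p.1.2.den * p.2.den) + p.1.2.negNum * (p.1.1.den * p.2.den) +
            p.2.posNum * (p.1.1.den * p.1.2.den) :=
    nat_eq
      (((px.nat_mul (dy.nat_mul dz)).nat_add (py.nat_mul (dx.nat_mul dz))).nat_add
        (nz.nat_mul (dx.nat_mul dy)))
      (((nx.nat_mul (dy.nat_mul dz)).nat_add (ny.nat_mul (dx.nat_mul dz))).nat_add
        (pz.nat_mul (dx.nat_mul dy)))
  have hg : ComputablePred fun p : (ℚ × ℚ) × ℚ => p.1.1 + p.1.2 = p.2 :=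
    h.of_eq fun p => Rat.add_eq_iff_nat p.1.1 p.1.2 p.2
  exact of_graph (f := fun p : ℚ × ℚ => p.1 + p.2) hg

theorem rat_add {f g : α → ℚ} (hf : Computable f) (hg : Computable g) :
    Computable fun a => f a + g a :=
  Rat.computable₂_add.comp hf hg

theorem _root_.Rat.computable₂_mul : Computable₂ fun x y : ℚ => x * y := by
  have hx : Computable fun p : (ℚ × ℚ) × ℚ => p.1.1 := fst.comp fst
  have hy : Computable fun p : (ℚ × ℚ) × ℚ => p.1.2 := snd.comp fst
  have hz : Computable fun p : (ℚ × ℚ) × ℚ => p.2 := snd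
  have dx := Rat.computable_den.comp hx
  have dy := Rat.computable_den.comp hy
  have dz := Rat.computable_den.comp hz
  have px := Rat.computable_posNum.comp hx
  have py := Rat.computable_posNum.comp hy
  have pz := Rat.computable_posNum.comp hz
  have nx := Rat.computable_negNum.comp hx
  have ny := Rat.computable_negNum.comp hy
  have nz := Rat.computable_negNum.comp hz
  have h : ComputablePred fun p : (ℚ × ℚ) × ℚ =>
      (p.1.1.posNum * p.1.2.posNum + p.1.1.negNum * p.1.2.negNum) * p.2.den +
            p.2.negNum * (p.1.1.den * p.1.2.den) =
          (p.1.1.posNum * p.1.2.negNum + p.1.1.negNum * p.1.2.posNum) * p.2.den +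
            p.2.posNum * (p.1.1.den * p.1.2.den) :=
    nat_eq
      ((((px.nat_mul py).nat_add (nx.nat_mul ny)).nat_mul dz).nat_add
        (nz.nat_mul (dx.nat_mul dy)))
      ((((px.nat_mul ny).nat_add (nx.nat_mul py)).nat_mul dz).nat_add
        (pz.nat_mul (dx.nat_mul dy)))
  have hg : ComputablePred fun p : (ℚ × ℚ) × ℚ => p.1.1 * p.1.2 = p.2 :=
    h.of_eq fun p => Rat.mul_eq_iff_nat p.1.1 p.1.2 p.2
  exact of_graph (f := fun p : ℚ × ℚ => p.1 * p.2) hg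

theorem rat_mul {f g : α → ℚ} (hf : Computable f) (hg : Computable g) :
    Computable fun a => f a * g a :=
  Rat.computable₂_mul.comp hf hg

theorem rat_sub {f g : α → ℚ} (hf : Computable f) (hg : Computable g) :
    Computable fun a => f a - g a :=
  (hf.rat_add ((const (-1 : ℚ)).rat_mul hg)).of_eq fun a => by ring

theorem rat_inv_natCast {f : α → ℕ} (hf : Computable f) :
    Computable fun a => ((f a + 1 : ℕ) : ℚ)⁻¹ := by
  have h : Computable fun n : ℕ => ((n + 1 : ℕ) : ℚ)⁻¹ := by
    refine of_graph ?_
    have hs : Computable fun p : ℕ × ℚ => p.1 + 1 := succ.comp fst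
    refine (nat_eq ((Rat.computable_posNum.comp snd).nat_mul hs)
      ((Rat.computable_den.comp snd).nat_add
        ((Rat.computable_negNum.comp snd).nat_mul hs))).of_eq ?_
    exact fun p => Rat.inv_natCast_eq_iff_nat p.1 p.2
  exact h.comp hf

theorem rat_le {f g : α → ℚ} (hf : Computable f) (hg : Computable g) :
    ComputablePred fun a => f a ≤ g a := by
  have h : ComputablePred fun p : ℚ × ℚ => p.1 ≤ p.2 := by
    have dx := Rat.computable_den.comp (fst (α := ℚ) (β := ℚ))
    have dy := Rat.computable_den.comp (snd (α := ℚ) (β := ℚ))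
    have px := Rat.computable_posNum.comp (fst (α := ℚ) (β := ℚ))
    have py := Rat.computable_posNum.comp (snd (α := ℚ) (β := ℚ))
    have nx := Rat.computable_negNum.comp (fst (α := ℚ) (β := ℚ))
    have ny := Rat.computable_negNum.comp (snd (α := ℚ) (β := ℚ))
    refine (nat_le ((px.nat_mul dy).nat_add (ny.nat_mul dx))
      ((py.nat_mul dx).nat_add (nx.nat_mul dy))).of_eq ?_
    exact fun p => Rat.le_iff_nat p.1 p.2
  exact h.comp (hf.pair hg)

theorem rat_max {f g : α → ℚ} (hf : Computable f) (hg : Computable g) :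
    Computable fun a => f a ⊔ g a :=
  (cond (hf.rat_le hg).decide hg hf).of_eq fun a => by
    by_cases h : f a ≤ g a
    · simp [h]
    · simp [h, (not_le.1 h).le]

theorem rat_partialSups {u : ℕ → ℚ} (hu : Computable u) : Computable (partialSups u) := by
  have hrec := nat_rec Computable.id (const (α := ℕ) (u 0))
    ((rat_max (snd.comp snd) (hu.comp (succ.comp (fst.comp snd)))).to₂ :
      Computable₂ fun (_ : ℕ) (p : ℕ × ℚ) => p.2 ⊔ u (p.1 + 1))
  refine hrec.of_eq fun n => ?_
  induction n with
  | zero => simp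
  | succ n ih =>
    rw [partialSups_add_one, ← ih]
    rfl

end Computable

namespace LeftCEApprox

variable {u v : ℕ → ℚ} {x y : ℝ}

theorem computable (h : LeftCEApprox u x) : Computable u := h.1

theorem monotone (h : LeftCEApprox u x) : Monotone u := h.2.1

theorem tendsto (h : LeftCEApprox u x) :
    Filter.Tendsto (fun n => (u n : ℝ)) Filter.atTop (nhds x) := h.2.2

theorem le (h : LeftCEApprox u x) (n : ℕ) : (u n : ℝ) ≤ x :=
  Monotone.ge_of_tendsto (Rat.cast_mono.comp h.monotone) h.tendsto n

theorem partialSups (hu : Computable u) (hle : ∀ n, (u n : ℝ) ≤ x)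
    (ht : Filter.Tendsto (fun n => (u n : ℝ)) Filter.atTop (nhds x)) :
    LeftCEApprox (partialSups u) x := by
  refine ⟨hu.rat_partialSups, (_root_.partialSups u).monotone, ?_⟩
  refine tendsto_of_tendsto_of_tendsto_of_le_of_le ht tendsto_const_nhds
    (fun n => Rat.cast_le.2 (le_partialSups u n)) (fun n => ?_)
  induction n with
  | zero => simpa using hle 0
  | succ n ih =>
    simp only [partialSups_add_one, Rat.cast_max]
    exact max_le ih (hle _)

theorem const_mul_add (hu : LeftCEApprox u x) (hv : LeftCEApprox v y) {c : ℚ} (hc : 0 ≤ c) :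
    LeftCEApprox (fun n => c * (u n + v n)) (c * (x + y)) := by
  refine ⟨(Computable.const c).rat_mul (hu.computable.rat_add hv.computable), ?_, ?_⟩
  · exact fun m n h => mul_le_mul_of_nonneg_left (add_le_add (hu.monotone h) (hv.monotone h)) hc
  · push_cast
    exact (hu.tendsto.add hv.tendsto).const_mul _

theorem sub_inv (hu : LeftCEApprox u x) :
    LeftCEApprox (fun n => u n - ((n + 1 : ℕ) : ℚ)⁻¹) x := by
  refine ⟨hu.computable.rat_sub Computable.id.rat_inv_natCast, ?_, ?_⟩
  · intro m n h
    have : ((n + 1 : ℕ) : ℚ)⁻¹ ≤ ((m + 1 : ℕ) : ℚ)⁻¹ := by gcongr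
    exact sub_le_sub (hu.monotone h) this
  · have h := hu.tendsto.sub (tendsto_one_div_add_atTop_nhds_zero_nat (𝕜 := ℝ))
    simpa using h

end LeftCEApprox

theorem SolovayRed.exists_approx {α β : ℝ} (h : SolovayRed α β) (hβ : LeftCE β) :
    ∃ q : ℚ, 0 < q ∧ ∃ a b : ℕ → ℚ, LeftCEApprox a α ∧ LeftCEApprox b β ∧
      ∀ s : ℕ, α - (a s : ℝ) ≤ (q : ℝ) * (β - (b s : ℝ)) := by
  obtain ⟨c, f, hf, h⟩ := h
  obtain ⟨b₀, hb₀⟩ := hβ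
  set b : ℕ → ℚ := fun n => b₀ n - ((n + 1 : ℕ) : ℚ)⁻¹ with hbdef
  have hb : LeftCEApprox b β := hb₀.sub_inv
  have hlt : ∀ n, (b n : ℝ) < β := fun n => by
    have h₁ := hb₀.le n
    have h₂ : (0 : ℝ) < (((n + 1 : ℕ) : ℚ)⁻¹ : ℚ) := by positivity
    simp only [hbdef, Rat.cast_sub]
    linarith
  choose r hr hrα hrc using fun n => h (b n) (hlt n)
  have hrcomp : Computable r := (hf.comp hb.computable).of_eq_tot hr
  have hc : (0 : ℝ) < c :=
    (mul_pos_iff_of_pos_right (sub_pos.2 (hlt 0))).1 (by linarith [hrα 0, hrc 0])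
  have ht : Filter.Tendsto (fun n => (r n : ℝ)) Filter.atTop (nhds α) := by
    refine tendsto_of_tendsto_of_tendsto_of_le_of_le
      (g := fun n => α - c * (β - (b n : ℝ))) ?_ tendsto_const_nhds
      (fun n => by have := hrc n; dsimp only; linarith) (fun n => (hrα n).le)
    simpa using ((hb.tendsto.const_sub β).const_mul (c : ℝ)).const_sub α
  refine ⟨c, by exact_mod_cast hc, partialSups r, b,
    LeftCEApprox.partialSups hrcomp (fun n => (hrα n).le) ht, hb, fun s => ?_⟩
  have h₁ : (r s : ℝ) ≤ (partialSups r s : ℚ) := Rat.cast_le.2 (le_partialSups r s)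
  linarith [hrc s]

theorem SolovayRed.of_approx {α β : ℝ} {q : ℚ} {a b : ℕ → ℚ} (hq : 0 < q)
    (ha : LeftCEApprox a α) (hb : LeftCEApprox b β)
    (h : ∀ s : ℕ, α - (a s : ℝ) ≤ (q : ℝ) * (β - (b s : ℝ))) : SolovayRed α β := by
  have hsearch : ComputablePred fun p : ℚ × ℕ => ¬ b p.2 ≤ p.1 :=
    ((hb.computable.comp Computable.snd).rat_le Computable.fst).not
  have hfind : Partrec fun x : ℚ => Nat.rfind fun n => Part.some (decide (¬ b n ≤ x)) :=
    Partrec.rfind hsearch.decide.partrec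
  have hval : Computable₂ fun (x : ℚ) (n : ℕ) => a n - (b n - x) :=
    (ha.computable.comp Computable.snd).rat_sub
      ((hb.computable.comp Computable.snd).rat_sub Computable.fst)
  refine ⟨q + 2, _, hfind.map hval, fun x hx => ?_⟩
  have hex : ∃ n, ¬ b n ≤ x := by
    obtain ⟨n, hn⟩ := (hb.tendsto.eventually_const_lt hx).exists
    exact ⟨n, not_le.2 (Rat.cast_lt.1 hn)⟩
  obtain ⟨n, hn⟩ := Part.dom_iff_mem.1 (Nat.rfind_dom'.2
    (hex.imp fun n hn => ⟨by simpa using hn, fun _ => trivial⟩) :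
      (Nat.rfind fun n => Part.some (decide (¬ b n ≤ x))).Dom)
  have hbn : x < b n := by simpa using Nat.rfind_spec hn
  have hbn' : (x : ℝ) < b n := Rat.cast_lt.2 hbn
  refine ⟨_, Part.mem_map _ hn, ?_, ?_⟩
  · push_cast
    linarith [ha.le n]
  · push_cast
    have h₁ : (q : ℝ) * (β - b n) ≤ q * (β - x) := by
      have : (0 : ℝ) < q := by exact_mod_cast hq
      gcongr
    linarith [h n, hb.le n]

/-- equivalent characterizations of Solovay reducibility on left-c.e. reals. -/
theorem stmt_5 (α β : ℝ) (hα : LeftCE α) (hβ : LeftCE β) :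
    List.TFAE [
      SolovayRed α β,
      ∃ q : ℚ, 0 < q ∧ LeftCE ((q : ℝ) * β - α),
      ∃ q : ℚ, 0 < q ∧ ∃ a b : ℕ → ℚ, LeftCEApprox a α ∧ LeftCEApprox b β ∧
        ∀ s : ℕ, α - (a s : ℝ) ≤ (q : ℝ) * (β - (b s : ℝ)),
      ∃ q : ℚ, 0 < q ∧ ∃ a b : ℕ → ℚ, LeftCEApprox a α ∧ LeftCEApprox b β ∧
        ∀ s : ℕ, (a (s+1) : ℝ) - (a s : ℝ) ≤ (q : ℝ) * ((b (s+1) : ℝ) - (b s : ℝ))] := by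
  tfae_have 1 → 3 := fun h => h.exists_approx hβ
  tfae_have 3 → 1 := fun ⟨_, hq, _, _, ha, hb, h⟩ => SolovayRed.of_approx hq ha hb h
  tfae_have 3 → 2 := by
    rintro ⟨q, hq, a, b, ha, hb, h⟩
    refine ⟨q, hq, _, LeftCEApprox.partialSups (u := fun s => q * b s - a s)
      (((Computable.const q).rat_mul hb.computable).rat_sub ha.computable) (fun s => ?_) ?_⟩
    · push_cast
      linarith [h s]
    · push_cast
      exact (hb.tendsto.const_mul _).sub ha.tendsto
  tfae_have 2 → 4 := by
    rintro ⟨q, hq, g, hg⟩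
    obtain ⟨a, ha⟩ := hα
    have hq' : (q : ℝ) ≠ 0 := by exact_mod_cast hq.ne'
    have hb := hg.const_mul_add ha (inv_nonneg.2 hq.le)
    rw [sub_add_cancel, Rat.cast_inv, inv_mul_cancel_left₀ hq'] at hb
    refine ⟨q, hq, a, _, ha, hb, fun s => ?_⟩
    have hmono : (g s : ℝ) ≤ g (s + 1) := Rat.cast_le.2 (hg.monotone s.le_succ)
    push_cast
    rw [mul_sub, mul_inv_cancel_left₀ hq', mul_inv_cancel_left₀ hq']
    linarith
  tfae_have 4 → 3 := by
    rintro ⟨q, hq, a, b, ha, hb, h⟩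
    refine ⟨q, hq, a, b, ha, hb, fun s => ?_⟩
    have hmono : Monotone fun s => (q : ℝ) * b s - a s :=
      monotone_nat_of_le_succ fun s => by linarith [h s]
    linarith [hmono.ge_of_tendsto ((hb.tendsto.const_mul _).sub ha.tendsto) s]
  tfae_finish
end
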